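/- There exists a compact set E ⊆ ℝ of positive Lebesgue measure such that: (i) every nonzero finite complex Borel measure μ on ℝ supported in E satisfies ∫_ℝ |μ̂(ξ)|^q dξ = ∞ for every q ∈ (0,2); and (ii) there exists a nonzero finite complex Borel measure ν supported in E such that for every A > 0 there is a constant C(A) > 0 with |ν̂(ξ)| ≤ C(A)·ξ^{−A} for all ξ > 0. -/

import Mathlib

open MeasureTheory Filter Topology Set

noncomputable section

/-- The Fourier transform at `ξ` of the finite complex Borel measure `g dν`
on `ℝ`: `μ̂(ξ) = ∫ e^{-2πiξx} g(x) dν(x)`. (Every finite complex Borel measure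
arises this way, e.g. with `ν` its total variation.) -/
def cmFT (ν : Measure ℝ) (g : ℝ → ℂ) (ξ : ℝ) : ℂ :=
  ∫ x, Complex.exp (-(((2 * Real.pi * ξ * x : ℝ) : ℂ) * Complex.I)) * g x ∂ν

open scoped ContDiff

theorem HasSum.of_eq {ι E : Type*} [AddCommMonoid E] [TopologicalSpace E] {f g : ι → E} {a b : E}
    (h : HasSum f a) (hfg : ∀ i, f i = g i) (hab : a = b) : HasSum g b := by
  rw [← hab, ← funext hfg]; exact h

/-- The nontrivial Fourier coefficients of the unit-mass tent function of half-width `1 / D`. -/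
def tentCoeff (D k : ℕ) : ℝ :=
  (D : ℝ) ^ 2 * Real.sin (Real.pi * k / D) ^ 2 / (Real.pi ^ 2 * (k : ℝ) ^ 2)

theorem tentCoeff_zero (D : ℕ) : tentCoeff D 0 = 0 := by simp [tentCoeff]

theorem tentCoeff_nonneg (D k : ℕ) : 0 ≤ tentCoeff D k := by
  unfold tentCoeff; positivity

theorem tentCoeff_le_one {D : ℕ} (hD : 0 < D) (k : ℕ) : tentCoeff D k ≤ 1 := by
  unfold tentCoeff
  rcases Nat.eq_zero_or_pos k with rfl | hk
  · simp
  have hk' : (0 : ℝ) < k := by exact_mod_cast hk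
  have hD' : (0 : ℝ) < D := by exact_mod_cast hD
  rw [div_le_one (by positivity)]
  have h1 : Real.sin (Real.pi * k / D) ^ 2 ≤ (Real.pi * k / D) ^ 2 := by
    rw [sq_le_sq]
    exact Real.abs_sin_le_abs
  calc (D : ℝ) ^ 2 * Real.sin (Real.pi * k / D) ^ 2 ≤ (D : ℝ) ^ 2 * (Real.pi * k / D) ^ 2 := by
        gcongr
    _ = _ := by field_simp

theorem tentCoeff_le_div (D k : ℕ) : tentCoeff D k ≤ (D : ℝ) ^ 2 / (k : ℝ) ^ 2 := by
  unfold tentCoeff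
  rcases Nat.eq_zero_or_pos k with rfl | hk
  · simp
  have hk' : (0 : ℝ) < k := by exact_mod_cast hk
  have h2 := Real.sin_sq_le_one (Real.pi * k / D)
  have h3 : (1 : ℝ) ≤ Real.pi ^ 2 := by nlinarith [Real.pi_gt_three]
  apply div_le_div₀ (by positivity) _ (by positivity)
  · nlinarith [sq_nonneg (k : ℝ)]
  · nlinarith [sq_nonneg (D : ℝ)]

theorem hasSum_cos_div_sq {x : ℝ} (hx : x ∈ Icc (0 : ℝ) 1) :
    HasSum (fun n : ℕ => 1 / (n : ℝ) ^ 2 * Real.cos (2 * Real.pi * n * x))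
      (Real.pi ^ 2 * (x ^ 2 - x + 1 / 6)) := by
  have h := hasSum_one_div_nat_pow_mul_cos (k := 1) one_ne_zero hx
  refine h.of_eq (fun n => by simp) ?_
  have : (Polynomial.map (algebraMap ℚ ℝ) (Polynomial.bernoulli (2 * 1))).eval x
      = x ^ 2 - x + 1 / 6 := by
    simp [Polynomial.bernoulli, Finset.sum_range_succ, Polynomial.eval_add, bernoulli_two,
      bernoulli_one]
    ring
  rw [this]
  norm_num [Nat.factorial]
  left
  ring

theorem hasSum_tentCoeff_cos {D : ℕ} (hD : 2 ≤ D) {x : ℝ} (hx : x ∈ Icc (0 : ℝ) 1)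
    {y z : ℝ} (hy : y ∈ Icc (0 : ℝ) 1) (hz : z ∈ Icc (0 : ℝ) 1)
    (hy' : ∀ n : ℕ, Real.cos (2 * Real.pi * n * y) = Real.cos (2 * Real.pi * n * (x + 1 / D)))
    (hz' : ∀ n : ℕ, Real.cos (2 * Real.pi * n * z) = Real.cos (2 * Real.pi * n * (x - 1 / D))) :
    HasSum (fun k : ℕ => tentCoeff D k * (2 * Real.cos (2 * Real.pi * k * x)))
      ((D : ℝ) ^ 2 / 2 * (2 * (x ^ 2 - x) - (y ^ 2 - y) - (z ^ 2 - z))) := by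
  have h := ((((hasSum_cos_div_sq hx).mul_left 2).sub (hasSum_cos_div_sq hy)).sub
    (hasSum_cos_div_sq hz)).mul_left ((D : ℝ) ^ 2 / (2 * Real.pi ^ 2))
  have hD' : (0 : ℝ) < D := by positivity
  refine h.of_eq (fun k => ?_) ?_
  · rw [hy', hz']
    have e1 : 2 * Real.pi * k * (x + 1 / D) = 2 * Real.pi * k * x + 2 * (Real.pi * k / D) := by
      field_simp
    have e2 : 2 * Real.pi * k * (x - 1 / D) = 2 * Real.pi * k * x - 2 * (Real.pi * k / D) := by
      field_simp
    rw [e1, e2, Real.cos_add, Real.cos_sub, Real.cos_two_mul (Real.pi * k / D), Real.cos_sq']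
    unfold tentCoeff
    rcases Nat.eq_zero_or_pos k with rfl | hk
    · simp
    have hk' : (0 : ℝ) < k := by exact_mod_cast hk
    field_simp
    ring
  · field_simp
    ring

/-- Away from the support of the tent function its Fourier series sums to zero. -/
theorem hasSum_tentCoeff_off {D : ℕ} (hD : 2 ≤ D) {x : ℝ}
    (h1 : 1 / (D : ℝ) ≤ Int.fract x) (h2 : Int.fract x ≤ 1 - 1 / (D : ℝ)) :
    HasSum (fun k : ℕ => tentCoeff D k * (2 * Real.cos (2 * Real.pi * k * x))) (-1) := by
  have hD' : (0 : ℝ) < D := by positivity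
  have hd : 0 < 1 / (D : ℝ) := by positivity
  have h := hasSum_tentCoeff_cos hD (x := Int.fract x) (y := Int.fract x + 1 / D)
    (z := Int.fract x - 1 / D) ⟨by linarith, by linarith⟩ ⟨by linarith, by linarith⟩
    ⟨by linarith, by linarith⟩ (fun _ => rfl) (fun _ => rfl)
  refine h.of_eq (fun k => ?_) ?_
  · have : 2 * Real.pi * k * x = 2 * Real.pi * k * Int.fract x + ((k * ⌊x⌋ : ℤ) : ℝ) * (2 * Real.pi) := by
      conv_lhs => rw [← Int.fract_add_floor x]
      push_cast; ring
    rw [this, Real.cos_add_int_mul_two_pi]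
  · field_simp
    ring

theorem hasSum_tentCoeff {D : ℕ} (hD : 2 ≤ D) :
    HasSum (tentCoeff D) (((D : ℝ) - 1) / 2) := by
  have hD' : (0 : ℝ) < D := by positivity
  have hD2 : (2 : ℝ) ≤ D := by exact_mod_cast hD
  have hd : 0 < 1 / (D : ℝ) := by positivity
  have hd1 : 1 / (D : ℝ) ≤ 1 := by rw [div_le_one hD']; linarith
  have h := hasSum_tentCoeff_cos hD (x := 0) (y := 1 / D) (z := 1 / D) (by simp)
    ⟨hd.le, hd1⟩ ⟨hd.le, hd1⟩ (fun _ => by simp) (fun n => by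
      rw [← Real.cos_neg]; congr 1; ring)
  have h' := h.div_const 2
  refine h'.of_eq (fun k => by simp) ?_
  · field_simp
    ring

theorem injOn_mul_add {r K N : ℕ} (hN : K * r < N) :
    Set.InjOn (fun x : ℕ × ℕ => x.2 * (N + x.1))
      ((Finset.range r ×ˢ Finset.Ioc 0 K : Finset (ℕ × ℕ)) : Set (ℕ × ℕ)) := by
  have key : ∀ j k j' k' : ℕ, j < r → j' < r → 0 < k → k ≤ K → 0 < k' → k' ≤ K →
      k * (N + j) = k' * (N + j') → k ≤ k' := by
    intro j k j' k' hj hj' hk hk1 hk' hk1' h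
    by_contra hlt
    have h1 : k' + 1 ≤ k := by omega
    have h2 : (k' + 1) * (N + j) ≤ k' * (N + j') := h ▸ Nat.mul_le_mul_right _ h1
    have h3 : k' * j' ≤ K * r := Nat.mul_le_mul hk1' hj'.le
    nlinarith
  rintro ⟨j, k⟩ h1 ⟨j', k'⟩ h2 h
  simp only [Finset.coe_product, Finset.coe_range, Finset.coe_Ioc, Set.mem_prod, Set.mem_Iio,
    Set.mem_Ioc] at h1 h2 h
  have hk : k = k' := le_antisymm (key j k j' k' h1.1 h2.1 h1.2.1 h1.2.2 h2.2.1 h2.2.2 h)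
    (key j' k' j k h2.1 h1.1 h2.2.1 h2.2.2 h1.2.1 h1.2.2 h.symm)
  subst hk
  have := Nat.eq_of_mul_eq_mul_left h1.2.1 h
  simp only [Prod.mk.injEq, and_true]
  omega

theorem sum_tentCoeff_mul_le {p q : ℝ} (hpq : p.HolderConjugate q) {b : ℕ → ℝ} (hb : ∀ m, 0 ≤ b m)
    (hs : Summable fun m => b m ^ q) {D r K N : ℕ} (hD : 2 ≤ D) (hN : K * r < N) :
    ∑ j ∈ Finset.range r, ∑ k ∈ Finset.Ioc 0 K, tentCoeff D k * b (k * (N + j))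
      ≤ ((r : ℝ) * D) ^ (1 / p) * (∑' m, b m ^ q) ^ (1 / q) := by
  rw [← Finset.sum_product' (f := fun j k => tentCoeff D k * b (k * (N + j)))]
  refine (Real.inner_le_Lp_mul_Lq_of_nonneg _ hpq (fun i _ => tentCoeff_nonneg D i.2)
    (fun i _ => hb _)).trans ?_
  have hbq : ∀ m, 0 ≤ b m ^ q := fun m => Real.rpow_nonneg (hb m) _
  have hp0 : 0 ≤ 1 / p := by have := hpq.pos; positivity
  have hq0 : 0 ≤ 1 / q := by have := hpq.symm.pos; positivity
  apply mul_le_mul _ _ (Real.rpow_nonneg (Finset.sum_nonneg fun i _ => hbq _) _) (by positivity)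
  · apply Real.rpow_le_rpow (Finset.sum_nonneg fun i _ => Real.rpow_nonneg (tentCoeff_nonneg _ _) _)
      _ hp0
    rw [Finset.sum_product' (f := fun j k => tentCoeff D k ^ p)]
    simp only [Finset.sum_const, Finset.card_range, nsmul_eq_mul]
    gcongr
    calc ∑ k ∈ Finset.Ioc 0 K, tentCoeff D k ^ p ≤ ∑ k ∈ Finset.Ioc 0 K, tentCoeff D k := by
          apply Finset.sum_le_sum
          intro k _
          exact Real.rpow_le_self_of_le_one (tentCoeff_nonneg _ _)
            (tentCoeff_le_one (by omega) _) hpq.lt.le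
      _ ≤ ((D : ℝ) - 1) / 2 :=
          sum_le_hasSum _ (fun i _ => tentCoeff_nonneg _ _) (hasSum_tentCoeff hD)
      _ ≤ D := by
          have : (0 : ℝ) ≤ D := by positivity
          linarith
  · apply Real.rpow_le_rpow (Finset.sum_nonneg fun i _ => hbq _) _ hq0
    rw [← Finset.sum_image (f := fun m => b m ^ q) (g := fun x : ℕ × ℕ => x.2 * (N + x.1))
      (injOn_mul_add hN)]
    exact hs.sum_le_tsum _ (fun i _ => hbq _)

/-- If a tent-function identity holds along `r` nearby frequencies `N + j`, then the zeroth term of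
an `ℓ^q` sequence is small. -/
theorem norm_le_of_tent_identity {p q : ℝ} (hpq : p.HolderConjugate q) {a : ℤ → ℂ}
    (hs : Summable fun m => ‖a m‖ ^ q) {B : ℝ} (hB : ∀ m, ‖a m‖ ≤ B)
    {D r K N : ℕ} (hD : 2 ≤ D) (hK : 0 < K) (hr : 0 < r) (hN : K * r < N)
    (hid : ∀ j < r, HasSum (fun k : ℕ => (tentCoeff D k : ℂ) *
      (a (-((k * (N + j) : ℕ) : ℤ)) + a ((k * (N + j) : ℕ) : ℤ))) (-a 0)) :
    ‖a 0‖ ≤ 2 * (((r : ℝ) * D) ^ (1 / p) / r) * (∑' m, ‖a m‖ ^ q) ^ (1 / q)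
      + 2 * B * (D ^ 2 / K) := by
  have hB0 : 0 ≤ B := (norm_nonneg _).trans (hB 0)
  have hK' : (0 : ℝ) < K := by exact_mod_cast hK
  have hr' : (0 : ℝ) < r := by exact_mod_cast hr
  have h1 : ∀ j < r, ‖a 0‖ ≤ ∑ k ∈ Finset.Ioc 0 K, tentCoeff D k * ‖a (-((k * (N + j) : ℕ) : ℤ))‖
      + ∑ k ∈ Finset.Ioc 0 K, tentCoeff D k * ‖a ((k * (N + j) : ℕ) : ℤ)‖ + 2 * B * (D ^ 2 / K) := by
    intro j hj
    have ht := ((hid j hj).tendsto_sum_nat.comp (tendsto_add_atTop_nat 1)).norm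
    rw [norm_neg] at ht
    refine le_of_tendsto ht ?_
    filter_upwards [eventually_ge_atTop K] with M hM
    simp only [Function.comp]
    refine (norm_sum_le _ _).trans ?_
    have e1 : ∀ k, ‖(tentCoeff D k : ℂ) * (a (-((k * (N + j) : ℕ) : ℤ)) + a ((k * (N + j) : ℕ) : ℤ))‖
        ≤ tentCoeff D k * (‖a (-((k * (N + j) : ℕ) : ℤ))‖ + ‖a ((k * (N + j) : ℕ) : ℤ)‖) := by
      intro k
      rw [norm_mul, Complex.norm_real, Real.norm_of_nonneg (tentCoeff_nonneg _ _)]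
      exact mul_le_mul_of_nonneg_left (norm_add_le _ _) (tentCoeff_nonneg _ _)
    refine (Finset.sum_le_sum fun k _ => e1 k).trans ?_
    have e2 : Finset.range (M + 1) = {0} ∪ (Finset.Ioc 0 K ∪ Finset.Ioc K M) := by
      ext k; simp; omega
    rw [e2, Finset.sum_union (by simp), Finset.sum_union
      (Finset.disjoint_left.2 fun k => by simp; omega), Finset.sum_singleton, tentCoeff_zero,
      zero_mul, zero_add]
    simp only [mul_add (tentCoeff _ _), Finset.sum_add_distrib]
    gcongr
    rw [← Finset.sum_add_distrib]
    calc ∑ k ∈ Finset.Ioc K M, (tentCoeff D k * ‖a (-((k * (N + j) : ℕ) : ℤ))‖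
          + tentCoeff D k * ‖a ((k * (N + j) : ℕ) : ℤ)‖)
        ≤ ∑ k ∈ Finset.Ioc K M, (2 * B * D ^ 2) * ((k : ℝ) ^ 2)⁻¹ := by
          apply Finset.sum_le_sum
          intro k _
          have f1 := tentCoeff_le_div D k
          have f0 := tentCoeff_nonneg D k
          have f2 := mul_le_mul_of_nonneg_left (hB (-((k * (N + j) : ℕ) : ℤ))) f0
          have f3 := mul_le_mul_of_nonneg_left (hB ((k * (N + j) : ℕ) : ℤ)) f0
          have f4 := mul_le_mul_of_nonneg_right f1 hB0
          rw [div_eq_mul_inv] at f4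
          linarith
      _ ≤ (2 * B * D ^ 2) * ((K : ℝ)⁻¹ - (M : ℝ)⁻¹) := by
          rw [← Finset.mul_sum]
          exact mul_le_mul_of_nonneg_left (sum_Ioc_inv_sq_le_sub hK.ne' hM) (by positivity)
      _ ≤ (2 * B * D ^ 2) * (K : ℝ)⁻¹ := by
          gcongr
          simp
      _ = _ := by rw [div_eq_mul_inv]; ring
  have h2 := Finset.sum_le_sum fun j (hj : j ∈ Finset.range r) => h1 j (Finset.mem_range.1 hj)
  have hinjp : Function.Injective (fun m : ℕ => (m : ℤ)) := Nat.cast_injective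
  have hinjn : Function.Injective (fun m : ℕ => -(m : ℤ)) := neg_injective.comp hinjp
  have hnn : ∀ m : ℤ, 0 ≤ ‖a m‖ ^ q := fun m => Real.rpow_nonneg (norm_nonneg _) _
  have hq0 : 0 ≤ 1 / q := by have := hpq.symm.pos; positivity
  have hp := sum_tentCoeff_mul_le hpq (fun m : ℕ => norm_nonneg (a m)) (hs.comp_injective hinjp) hD hN
  have hn := sum_tentCoeff_mul_le hpq (fun m : ℕ => norm_nonneg (a (-(m : ℤ))))
    (hs.comp_injective hinjn) hD hN
  have hp' : (∑' m : ℕ, ‖a m‖ ^ q) ^ (1 / q) ≤ (∑' m, ‖a m‖ ^ q) ^ (1 / q) :=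
    Real.rpow_le_rpow (tsum_nonneg fun m => hnn _) (tsum_comp_le_tsum_of_inj hs hnn hinjp) hq0
  have hn' : (∑' m : ℕ, ‖a (-(m : ℤ))‖ ^ q) ^ (1 / q) ≤ (∑' m, ‖a m‖ ^ q) ^ (1 / q) :=
    Real.rpow_le_rpow (tsum_nonneg fun m => hnn _) (tsum_comp_le_tsum_of_inj hs hnn hinjn) hq0
  have hc : 0 ≤ ((r : ℝ) * D) ^ (1 / p) := by positivity
  replace hp := hp.trans (mul_le_mul_of_nonneg_left hp' hc)
  replace hn := hn.trans (mul_le_mul_of_nonneg_left hn' hc)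
  simp only [Finset.sum_add_distrib, Finset.sum_const, Finset.card_range, nsmul_eq_mul] at h2
  have h3 : (r : ℝ) * ‖a 0‖ ≤ r * (2 * (((r : ℝ) * D) ^ (1 / p) / r) * (∑' m, ‖a m‖ ^ q) ^ (1 / q)
      + 2 * B * (D ^ 2 / K)) := by
    refine h2.trans ?_
    rw [mul_add]
    gcongr
    refine (add_le_add hn hp).trans (le_of_eq ?_)
    field_simp
    ring
  exact le_of_mul_le_mul_left h3 hr'

theorem norm_cexp_neg_mul_I (y : ℝ) : ‖Complex.exp (-((y : ℂ) * Complex.I))‖ = 1 := by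
  rw [← neg_mul, ← Complex.ofReal_neg, Complex.norm_exp_ofReal_mul_I]

theorem integrable_cexp_mul {ν : Measure ℝ} {g : ℝ → ℂ} (hg : Integrable g ν) (ξ : ℝ) :
    Integrable (fun x => Complex.exp (-(((2 * Real.pi * ξ * x : ℝ) : ℂ) * Complex.I)) * g x) ν := by
  refine hg.bdd_mul (c := 1) ?_ ?_
  · exact (by fun_prop : Continuous _).aestronglyMeasurable
  · exact .of_forall fun x => (norm_cexp_neg_mul_I _).le

theorem norm_cmFT_le (ν : Measure ℝ) (g : ℝ → ℂ) (ξ : ℝ) : ‖cmFT ν g ξ‖ ≤ ∫ x, ‖g x‖ ∂ν := by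
  refine (norm_integral_le_integral_norm _).trans_eq (integral_congr_ae (.of_forall fun x => ?_))
  simp only [norm_mul, norm_cexp_neg_mul_I, one_mul]

theorem cmFT_eq_fourierIntegral (ν : Measure ℝ) (g : ℝ → ℂ) (ξ : ℝ) :
    cmFT ν g ξ = VectorFourier.fourierIntegral Real.fourierChar ν (innerₗ ℝ) g ξ := by
  unfold cmFT VectorFourier.fourierIntegral
  refine integral_congr_ae (.of_forall fun x => ?_)
  simp only [Circle.smul_def, Real.fourierChar_apply, smul_eq_mul, innerₗ_apply_apply]
  congr 2
  simp
  ring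

theorem continuous_cmFT {ν : Measure ℝ} {g : ℝ → ℂ} (hg : Integrable g ν) :
    Continuous (cmFT ν g) := by
  rw [funext (cmFT_eq_fourierIntegral ν g)]
  exact VectorFourier.fourierIntegral_continuous Real.continuous_fourierChar
    (by simp only [innerₗ_apply_apply]; fun_prop) hg

theorem ae_eq_zero_of_cmFT_eq_zero {ν : Measure ℝ} [IsFiniteMeasure ν] {g : ℝ → ℂ}
    (hg : Integrable g ν) (h : ∀ ξ, cmFT ν g ξ = 0) : g =ᵐ[ν] 0 := by
  refine ae_eq_zero_of_integral_contDiff_smul_eq_zero hg.locallyIntegrable ?_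
  intro φ hφ hφc
  have hφ' : ContDiff ℝ ∞ (fun x => (φ x : ℂ)) := Complex.ofRealCLM.contDiff.comp hφ
  have hφc' : HasCompactSupport (fun x => (φ x : ℂ)) := hφc.comp_left Complex.ofReal_zero
  let Φ : SchwartzMap ℝ ℂ := hφc'.toSchwartzMap hφ'
  let Ψ : SchwartzMap ℝ ℂ := FourierTransformInv.fourierInv Φ
  have hΨ : FourierTransform.fourier (Ψ : ℝ → ℂ) = fun x => (φ x : ℂ) := by
    rw [← SchwartzMap.fourier_coe]
    simp [Ψ, Φ]
    rfl
  have hflip := VectorFourier.integral_fourierIntegral_smul_eq_flip (μ := (volume : Measure ℝ))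
    (ν := ν) (L := innerₗ ℝ) Real.continuous_fourierChar
    (by simp only [innerₗ_apply_apply]; fun_prop) Ψ.integrable hg
  have e1 : ∀ x, VectorFourier.fourierIntegral Real.fourierChar volume (innerₗ ℝ) Ψ x = φ x :=
    fun x => congrFun hΨ x
  have hsymm : (innerₗ ℝ).flip = innerₗ ℝ := by
    ext; simp
  simp only [e1, hsymm, ← cmFT_eq_fourierIntegral, h, smul_zero, integral_zero] at hflip
  rw [← hflip]
  refine integral_congr_ae (.of_forall fun x => ?_)
  simp

theorem hasSum_tentCoeff_cmFT {ν : Measure ℝ} {g : ℝ → ℂ} (hg : Integrable g ν)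
    {D M : ℕ} (hD : 2 ≤ D)
    (h : ∀ᵐ x ∂ν, g x ≠ 0 → 1 / (D : ℝ) ≤ Int.fract (M * x) ∧ Int.fract (M * x) ≤ 1 - 1 / (D : ℝ))
    (t : ℝ) :
    HasSum (fun k : ℕ => (tentCoeff D k : ℂ) *
      (cmFT ν g (t - (k * M : ℕ)) + cmFT ν g (t + (k * M : ℕ)))) (-cmFT ν g t) := by
  let F : ℕ → ℝ → ℂ := fun k x => (tentCoeff D k : ℂ) *
    (Complex.exp (-(((2 * Real.pi * (t - (k * M : ℕ)) * x : ℝ) : ℂ) * Complex.I)) * g x +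
    Complex.exp (-(((2 * Real.pi * (t + (k * M : ℕ)) * x : ℝ) : ℂ) * Complex.I)) * g x)
  have hFi : ∀ k, Integrable (F k) ν := fun k =>
    ((integrable_cexp_mul hg _).add (integrable_cexp_mul hg _)).const_mul _
  have hFn : Summable fun k => ∫ x, ‖F k x‖ ∂ν := by
    refine Summable.of_nonneg_of_le (fun k => integral_nonneg fun x => norm_nonneg _) (fun k => ?_)
      ((hasSum_tentCoeff hD).summable.mul_right (2 * ∫ x, ‖g x‖ ∂ν))
    rw [← integral_const_mul, ← integral_const_mul]
    refine integral_mono (hFi k).norm ((hg.norm.const_mul _).const_mul _) fun x => ?_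
    simp only [F, norm_mul, Complex.norm_real, Real.norm_of_nonneg (tentCoeff_nonneg _ _)]
    refine mul_le_mul_of_nonneg_left ?_ (tentCoeff_nonneg _ _)
    refine (norm_add_le _ _).trans_eq ?_
    simp only [norm_mul, norm_cexp_neg_mul_I]
    ring
  refine (hasSum_integral_of_summable_integral_norm hFi hFn).of_eq (fun k => ?_) ?_
  · simp only [F]
    rw [integral_const_mul, integral_add (integrable_cexp_mul hg _) (integrable_cexp_mul hg _)]
    rfl
  · unfold cmFT
    rw [← integral_neg]
    refine integral_congr_ae ?_
    filter_upwards [h] with x hx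
    by_cases hgx : g x = 0
    · simp [F, hgx]
    obtain ⟨h1, h2⟩ := hx hgx
    have hs := Complex.hasSum_ofReal.2 (hasSum_tentCoeff_off hD h1 h2)
    have hs' := hs.mul_right
      (Complex.exp (-(((2 * Real.pi * t * x : ℝ) : ℂ) * Complex.I)) * g x)
    refine HasSum.tsum_eq (hs'.of_eq (fun k => ?_) (by simp))
    have key : 2 * Complex.cos ((2 * Real.pi * k * (M * x) : ℝ) : ℂ) *
        Complex.exp (-(((2 * Real.pi * t * x : ℝ) : ℂ) * Complex.I)) =
        Complex.exp (-(((2 * Real.pi * (t - (k * M : ℕ)) * x : ℝ) : ℂ) * Complex.I)) +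
        Complex.exp (-(((2 * Real.pi * (t + (k * M : ℕ)) * x : ℝ) : ℂ) * Complex.I)) := by
      rw [Complex.two_cos, add_mul, ← Complex.exp_add, ← Complex.exp_add]
      push_cast
      ring_nf
    simp only [F]
    rw [← add_mul, ← key]
    push_cast
    ring

theorem ae_summable_comp_add_int {f : ℝ → ℝ} (hf : Measurable f) (hf0 : ∀ x, 0 ≤ f x)
    (h : ∫⁻ x, ENNReal.ofReal (f x) ≠ ⊤) (a : ℝ) :
    ∀ᵐ t ∂(volume.restrict (Ioc a (a + 1))), Summable fun m : ℤ => f (t + m) := by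
  have hm : ∀ m : ℤ, Measurable fun t => ENNReal.ofReal (f (t + m)) := fun m => by fun_prop
  have key : ∫⁻ t in Ioc a (a + 1), ∑' m : ℤ, ENNReal.ofReal (f (t + m)) ≠ ⊤ := by
    rw [lintegral_tsum fun m => (hm m).aemeasurable]
    have e : ∀ m : ℤ, ∫⁻ t in Ioc a (a + 1), ENNReal.ofReal (f (t + m))
        = ∫⁻ t in Ioc (a + m) (a + m + 1), ENNReal.ofReal (f t) := by
      intro m
      have := (measurePreserving_add_right volume (m : ℝ)).setLIntegral_comp_preimage_emb
        (measurableEmbedding_addRight (m : ℝ)) (fun t => ENNReal.ofReal (f t))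
        (Ioc (a + m) (a + m + 1))
      rw [← this]
      congr 2
      ext t
      simp only [mem_Ioc, mem_preimage]
      constructor <;> rintro ⟨h1, h2⟩ <;> constructor <;> linarith
    rw [tsum_congr e, ← lintegral_iUnion (fun m => measurableSet_Ioc)
      (pairwise_disjoint_Ioc_add_intCast a), iUnion_Ioc_add_intCast, setLIntegral_univ]
    exact h
  filter_upwards [ae_lt_top (Measurable.tsum hm) key] with t ht
  have := ENNReal.summable_toReal ht.ne
  simpa only [ENNReal.toReal_ofReal (hf0 _)] using this

/-- The base frequency of the block with parameters `L` and `n`. -/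
def baseFreq (L n : ℕ) : ℕ := L ^ (3 * n + 6) * L ^ n + 1

theorem tendsto_tent_main {L : ℕ → ℕ} (hL : ∀ n, 2 ≤ L n) {p : ℝ} (hp : 2 < p) :
    Tendsto (fun n => ((((L n ^ n : ℕ) : ℝ) * (L n ^ (n + 2) : ℕ)) ^ (1 / p) / (L n ^ n : ℕ)))
      atTop (𝓝 0) := by
  have hc : 0 < 1 - 2 / p := by
    rw [sub_pos, div_lt_one (by linarith)]; exact hp
  have e : ∀ n : ℕ, ((((L n ^ n : ℕ) : ℝ) * (L n ^ (n + 2) : ℕ)) ^ (1 / p) / (L n ^ n : ℕ))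
      = (L n : ℝ) ^ (2 / p - n * (1 - 2 / p)) := by
    intro n
    have h0 : (0 : ℝ) < L n := by have := hL n; positivity
    push_cast
    rw [← pow_add, ← Real.rpow_natCast, ← Real.rpow_natCast, ← Real.rpow_mul h0.le,
      ← Real.rpow_sub h0]
    congr 1
    push_cast
    field_simp
    ring
  have ht : Tendsto (fun n : ℕ => 2 / p - n * (1 - 2 / p)) atTop atBot :=
    tendsto_atBot_add_const_left _ _ (tendsto_neg_atTop_atBot.comp
      (tendsto_natCast_atTop_atTop.atTop_mul_const hc))
  have h2 : Tendsto (fun n : ℕ => (2 : ℝ) ^ (2 / p - n * (1 - 2 / p))) atTop (𝓝 0) :=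
    (tendsto_rpow_atBot_of_base_gt_one 2 (by norm_num)).comp ht
  refine squeeze_zero' (.of_forall fun n => by positivity) ?_ h2
  filter_upwards [ht.eventually_le_atBot 0] with n hn
  rw [e]
  exact Real.rpow_le_rpow_of_nonpos (by norm_num) (by exact_mod_cast hL n) hn

theorem tendsto_tent_tail {L : ℕ → ℕ} (hL : ∀ n, 2 ≤ L n) :
    Tendsto (fun n => (((L n ^ (n + 2) : ℕ) : ℝ) ^ 2 / (L n ^ (3 * n + 6) : ℕ))) atTop (𝓝 0) := by
  have h2 : Tendsto (fun n : ℕ => (1 / 2 : ℝ) ^ n) atTop (𝓝 0) :=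
    tendsto_pow_atTop_nhds_zero_of_lt_one (by norm_num) (by norm_num)
  refine squeeze_zero (fun n => by positivity) (fun n => ?_) h2
  have h0 : (2 : ℝ) ≤ L n := by exact_mod_cast hL n
  have h1 : (0 : ℝ) < L n := by linarith
  push_cast
  rw [show 3 * n + 6 = (n + 2) * 2 + (n + 2) by ring, pow_add _ ((n + 2) * 2), pow_mul,
    div_mul_cancel_left₀ (by positivity), one_div, inv_pow]
  gcongr
  calc (2 : ℝ) ^ n ≤ 2 ^ (n + 2) := pow_le_pow_right₀ (by norm_num) (by omega)
    _ ≤ _ := by gcongr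

theorem ae_eq_zero_of_lintegral_ne_top {L : ℕ → ℕ} (hL : ∀ n, 2 ≤ L n)
    {ν : Measure ℝ} [IsFiniteMeasure ν] {g : ℝ → ℂ} (hg : Integrable g ν)
    (h : ∀ n, ∀ j < L n ^ n, ∀ᵐ x ∂ν, g x ≠ 0 →
      1 / ((L n ^ (n + 2) : ℕ) : ℝ) ≤ Int.fract (((baseFreq (L n) n + j : ℕ) : ℝ) * x) ∧
      Int.fract (((baseFreq (L n) n + j : ℕ) : ℝ) * x) ≤ 1 - 1 / ((L n ^ (n + 2) : ℕ) : ℝ))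
    {q : ℝ} (hq2 : q < 2)
    (hfin : ∫⁻ ξ : ℝ, ENNReal.ofReal (‖cmFT ν g ξ‖ ^ q) ≠ ⊤) : g =ᵐ[ν] 0 := by
  have hcont := continuous_cmFT hg
  set B := ∫ x, ‖g x‖ ∂ν
  have hB0 : 0 ≤ B := integral_nonneg fun x => norm_nonneg _
  have key : ∀ t : ℝ, (Summable fun m : ℤ => ‖cmFT ν g (t + m)‖ ^ q) → cmFT ν g t = 0 := by
    intro t ht
    obtain ⟨q', hq', hqq, hq2'⟩ : ∃ q' : ℝ, 1 < q' ∧ q ≤ q' ∧ q' < 2 :=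
      ⟨max q (3 / 2), lt_max_of_lt_right (by norm_num), le_max_left _ _, max_lt hq2 (by norm_num)⟩
    have ht' : Summable fun m : ℤ => ‖cmFT ν g (t + m)‖ ^ q' := by
      by_cases hB : B = 0
      · have : ∀ m : ℤ, ‖cmFT ν g (t + m)‖ = 0 := fun m =>
          le_antisymm (hB ▸ norm_cmFT_le ν g _) (norm_nonneg _)
        simp only [this, Real.zero_rpow (by linarith : q' ≠ 0)]
        exact summable_zero
      refine Summable.of_nonneg_of_le (fun m => by positivity) (fun m => ?_)
        (ht.mul_right (B ^ (q' - q)))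
      rcases (norm_nonneg (cmFT ν g (t + m))).eq_or_lt with h0 | h0
      · rw [← h0, Real.zero_rpow (by linarith : q' ≠ 0)]
        positivity
      · rw [show q' = q + (q' - q) by ring, Real.rpow_add h0, show q + (q' - q) - q = q' - q by ring]
        gcongr
        exact norm_cmFT_le ν g _
    have hpq : (Real.conjExponent q').HolderConjugate q' :=
      (Real.HolderConjugate.conjExponent hq').symm
    have hp : 2 < Real.conjExponent q' := by
      rw [Real.conjExponent, lt_div_iff₀ (by linarith)]
      linarith
    have hbound : ∀ n, ‖cmFT ν g t‖ ≤ _ := fun n => by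
      have := norm_le_of_tent_identity hpq (a := fun m : ℤ => cmFT ν g (t + m)) ht'
        (fun m => norm_cmFT_le ν g _) (D := L n ^ (n + 2)) (r := L n ^ n) (K := L n ^ (3 * n + 6))
        (N := baseFreq (L n) n)
        ((hL n).trans (Nat.le_self_pow (by omega) _)) (by have := hL n; positivity)
        (by have := hL n; positivity) (Nat.lt_succ_self _) (fun j hj => by
          have := hasSum_tentCoeff_cmFT hg ((hL n).trans (Nat.le_self_pow (by omega) _)) (h n j hj) t
          refine this.of_eq (fun k => ?_) (by simp)
          congr 2
          · congr 1
            push_cast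
            ring)
      simpa only [Int.cast_zero, add_zero] using this
    have hlim := (((tendsto_tent_main hL hp).const_mul 2).mul_const
      ((∑' m : ℤ, ‖cmFT ν g (t + m)‖ ^ q') ^ (1 / q'))).add
      ((tendsto_tent_tail hL).const_mul (2 * B))
    simp only [mul_zero, zero_mul, add_zero] at hlim
    exact norm_le_zero_iff.1 (ge_of_tendsto' hlim hbound)
  apply ae_eq_zero_of_cmFT_eq_zero hg
  intro ξ
  have hae := ae_summable_comp_add_int (f := fun ξ => ‖cmFT ν g ξ‖ ^ q)
    (by have := hcont.measurable; fun_prop) (fun x => by positivity) hfin ξ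
  have hcl : IsClosed {t | cmFT ν g t = 0} := isClosed_eq hcont continuous_const
  have hmem : ξ ∈ closure {t | cmFT ν g t = 0} := by
    rw [Metric.mem_closure_iff]
    intro ε hε
    by_contra! hcon
    have hpos : 0 < min ε 1 := lt_min hε one_pos
    have hsub : Ioo ξ (ξ + min ε 1) ⊆ Ioc ξ (ξ + 1) := fun t ht =>
      ⟨ht.1, ht.2.le.trans (by gcongr; exact min_le_right _ _)⟩
    have hae' := ae_restrict_of_ae_restrict_of_subset hsub hae
    have : ∀ᵐ t ∂(volume.restrict (Ioo ξ (ξ + min ε 1))), False := by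
      filter_upwards [hae', ae_restrict_mem measurableSet_Ioo] with t ht htm
      have h1 := hcon t (key t ht)
      rw [Real.dist_eq, abs_sub_comm, abs_of_pos (by linarith [htm.1])] at h1
      have := min_le_left ε 1
      linarith [htm.2]
    rw [ae_iff] at this
    simp only [not_false_eq_true, ofPred_true, Measure.restrict_apply_univ, Real.volume_Ioo] at this
    simp only [add_sub_cancel_left, ENNReal.ofReal_eq_zero] at this
    linarith
  exact hcl.closure_subset hmem

theorem cmFT_restrict_eq_fourier {f : ℝ → ℂ} {s : Set ℝ} (hf : ∀ x, x ∉ s → f x = 0) (ξ : ℝ) :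
    cmFT (volume.restrict s) f ξ = FourierTransform.fourier f ξ := by
  rw [cmFT, setIntegral_eq_integral_of_forall_compl_eq_zero (fun x hx => by rw [hf x hx, mul_zero])]
  exact cmFT_eq_fourierIntegral volume f ξ

theorem iteratedDeriv_eq_zero_of_notMem {f : ℝ → ℂ} {s : Set ℝ} (hs : IsClosed s)
    (hf : ∀ x, x ∉ s → f x = 0) (n : ℕ) {x : ℝ} (hx : x ∉ s) : iteratedDeriv n f x = 0 := by
  have : f =ᶠ[𝓝 x] fun _ => 0 := by
    filter_upwards [hs.isOpen_compl.mem_nhds hx] with y hy using hf y hy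
  rw [this.iteratedDeriv_eq, iteratedDeriv_fun_const_zero]

theorem hasCompactSupport_of_forall_notMem_Icc {f : ℝ → ℂ} (hf : ∀ x, x ∉ Icc (0 : ℝ) 1 → f x = 0) :
    HasCompactSupport f :=
  HasCompactSupport.intro isCompact_Icc fun x hx => hf x hx

theorem norm_cmFT_mul_pow_le {f : ℝ → ℂ} (hf : ContDiff ℝ ∞ f)
    (h0 : ∀ x, x ∉ Icc (0 : ℝ) 1 → f x = 0) {n : ℕ} {B : ℝ}
    (hB : ∀ x, ‖iteratedFDeriv ℝ n f x‖ ≤ B) {ξ : ℝ} (hξ : 0 < ξ) :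
    ‖cmFT (volume.restrict (Icc 0 1)) f ξ‖ * ξ ^ n ≤ B := by
  have hcs := hasCompactSupport_of_forall_notMem_Icc h0
  have hinteg : ∀ k : ℕ, Integrable (iteratedDeriv k f) := fun k =>
    (hf.continuous_iteratedDeriv k (by exact_mod_cast le_top)).integrable_of_hasCompactSupport
      (HasCompactSupport.intro isCompact_Icc fun x hx =>
        iteratedDeriv_eq_zero_of_notMem isClosed_Icc h0 k hx)
  have h1 := congrFun (Real.fourier_iteratedDeriv (N := ⊤) (n := n) hf (fun k _ => hinteg k) le_top) ξ
  have h2 : ‖FourierTransform.fourier (iteratedDeriv n f) ξ‖ ≤ B := by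
    rw [← cmFT_restrict_eq_fourier
      (fun x hx => iteratedDeriv_eq_zero_of_notMem isClosed_Icc h0 n hx)]
    refine (norm_cmFT_le _ _ _).trans ?_
    refine (setIntegral_mono_on (hinteg n).norm.integrableOn (integrableOn_const (C := B) (hs := by simp))
      measurableSet_Icc fun x _ => ?_).trans_eq (by simp)
    rw [← norm_iteratedFDeriv_eq_norm_iteratedDeriv]
    exact hB x
  rw [h1, norm_smul, norm_pow] at h2
  have h3 : ‖(2 * Real.pi * Complex.I * ξ : ℂ)‖ = 2 * Real.pi * ξ := by
    simp [abs_of_pos hξ, abs_of_pos Real.pi_pos]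
  rw [cmFT_restrict_eq_fourier h0]
  refine le_trans ?_ h2
  rw [h3, mul_comm]
  gcongr
  nlinarith [Real.pi_gt_three]

/-- The derivatives of `f` at `x` up to order `n` grow at most geometrically. -/
def DerivBound {F : Type*} [NormedAddCommGroup F] [NormedSpace ℝ F] (n : ℕ) (f : ℝ → F) (x P R : ℝ) :
    Prop :=
  ∀ i ≤ n, ‖iteratedFDeriv ℝ i f x‖ ≤ P * R ^ i

section DerivBound

variable {F : Type*} [NormedAddCommGroup F] [NormedSpace ℝ F] {n : ℕ} {x P Q R S : ℝ}

theorem DerivBound.mono {f : ℝ → F} (h : DerivBound n f x P R) (hP : 0 ≤ P) (hR : 0 ≤ R)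
    (hPQ : P ≤ Q) (hRS : R ≤ S) : DerivBound n f x Q S := fun i hi =>
  (h i hi).trans (by have := hP.trans hPQ; gcongr)

theorem DerivBound.smul {𝕜 : Type*} [NormedField 𝕜] [NormedAlgebra ℝ 𝕜] [NormedSpace 𝕜 F]
    [IsScalarTower ℝ 𝕜 F] {f : ℝ → 𝕜} {g : ℝ → F} (hf : ContDiff ℝ ∞ f) (hg : ContDiff ℝ ∞ g)
    (hfb : DerivBound n f x P R) (hgb : DerivBound n g x Q S) :
    DerivBound n (fun y => f y • g y) x (P * Q) (R + S) := by
  intro i hi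
  refine (norm_iteratedFDeriv_smul_le hf hg x (by exact_mod_cast le_top)).trans ?_
  rw [add_pow, Finset.mul_sum]
  refine Finset.sum_le_sum fun k hk => ?_
  have hk' : k ≤ i := by simpa [Nat.lt_succ_iff] using hk
  have h1 := hfb k (hk'.trans hi)
  have h2 := hgb (i - k) ((Nat.sub_le i k).trans hi)
  have h3 := mul_le_mul h1 h2 (norm_nonneg _) ((norm_nonneg _).trans h1)
  calc _ = (i.choose k : ℝ) * (‖iteratedFDeriv ℝ k f x‖ * ‖iteratedFDeriv ℝ (i - k) g x‖) := by ring
    _ ≤ (i.choose k : ℝ) * (P * R ^ k * (Q * S ^ (i - k))) := by gcongr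
    _ = _ := by ring

theorem DerivBound.prod {ι : Type*} (s : Finset ι) {f : ι → ℝ → ℝ} (hf : ∀ i ∈ s, ContDiff ℝ ∞ (f i))
    (hb : ∀ i ∈ s, DerivBound n (f i) x 1 R) :
    DerivBound n (fun y => ∏ i ∈ s, f i y) x 1 (s.card * R) := by
  classical
  induction s using Finset.induction_on with
  | empty =>
    intro i hi
    rcases Nat.eq_zero_or_pos i with rfl | h
    · simp
    · simp [iteratedFDeriv_const_of_ne (𝕜 := ℝ) h.ne', h.ne']
  | insert a s ha ih =>
    have h1 := ih (fun i hi => hf i (Finset.mem_insert_of_mem hi))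
      (fun i hi => hb i (Finset.mem_insert_of_mem hi))
    have h2 := (hb a (Finset.mem_insert_self a s)).smul (hf a (Finset.mem_insert_self a s))
      (contDiff_prod fun i hi => hf i (Finset.mem_insert_of_mem hi)) h1
    simp only [smul_eq_mul, one_mul] at h2
    simp only [Finset.prod_insert ha, Finset.card_insert_of_notMem ha]
    push_cast
    rwa [add_comm (s.card : ℝ) 1, add_mul, one_mul]

theorem DerivBound.one_sub {f : ℝ → ℝ} (hf : ContDiff ℝ ∞ f) (h0 : 0 ≤ f x) (h1 : f x ≤ 1)
    (hb : DerivBound n f x 1 R) : DerivBound n (fun y => 1 - f y) x 1 R := by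
  intro i hi
  rcases Nat.eq_zero_or_pos i with rfl | h
  · simp [abs_le]
    constructor <;> linarith
  · have : iteratedFDeriv ℝ i (fun y => 1 - f y) x = - iteratedFDeriv ℝ i f x := by
      have e : (fun y => 1 - f y) = (fun _ => (1 : ℝ)) - f := rfl
      rw [e, iteratedFDeriv_sub contDiff_const (hf.of_le (by exact_mod_cast le_top)),
        iteratedFDeriv_const_of_ne (𝕜 := ℝ) h.ne']
      simp
    rw [this, norm_neg]
    exact hb i hi

end DerivBound

theorem exists_bound_iteratedFDeriv_of_hasCompactSupport {f : ℝ → ℂ} (hf : ContDiff ℝ ∞ f)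
    (hc : HasCompactSupport f) (n : ℕ) :
    ∃ C, 0 < C ∧ ∀ i ≤ n, ∀ x, ‖iteratedFDeriv ℝ i f x‖ ≤ C := by
  have : ∀ i : ℕ, ∃ C, ∀ x, ‖iteratedFDeriv ℝ i f x‖ ≤ C := fun i =>
    (hc.iteratedFDeriv i).exists_bound_of_continuous
      (hf.continuous_iteratedFDeriv (by exact_mod_cast le_top))
  choose C hC using this
  refine ⟨∑ i ∈ Finset.range (n + 1), |C i| + 1, by positivity, fun i hi x => ?_⟩
  calc _ ≤ |C i| := (hC i x).trans (le_abs_self _)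
    _ ≤ ∑ i ∈ Finset.range (n + 1), |C i| :=
      Finset.single_le_sum (f := fun i => |C i|) (fun _ _ => abs_nonneg _) (by simpa [Nat.lt_succ_iff])
    _ ≤ _ := by linarith

theorem Real.smoothTransition.exists_bound_iteratedFDeriv (n : ℕ) :
    ∃ C, 1 ≤ C ∧ ∀ i ≤ n, ∀ t, ‖iteratedFDeriv ℝ i Real.smoothTransition t‖ ≤ C := by
  have hconst : ∀ (i : ℕ) (c t : ℝ), ‖c‖ ≤ 1 → ‖iteratedFDeriv ℝ i (fun _ : ℝ => c) t‖ ≤ 1 := by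
    intro i c t hc
    rcases Nat.eq_zero_or_pos i with rfl | h
    · simpa using hc
    · simp [iteratedFDeriv_const_of_ne (𝕜 := ℝ) h.ne']
  have : ∀ i : ℕ, ∃ C, ∀ t ∈ Icc (0 : ℝ) 1, ‖iteratedFDeriv ℝ i Real.smoothTransition t‖ ≤ C :=
    fun i => isCompact_Icc.exists_bound_of_continuousOn
      ((Real.smoothTransition.contDiff (n := ⊤)).continuous_iteratedFDeriv
        (by exact_mod_cast le_top)).continuousOn
  choose C hC using this
  refine ⟨∑ i ∈ Finset.range (n + 1), |C i| + 1, by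
    have : 0 ≤ ∑ i ∈ Finset.range (n + 1), |C i| := by positivity
    linarith, fun i hi t => ?_⟩
  have hs : 0 ≤ ∑ i ∈ Finset.range (n + 1), |C i| := by positivity
  by_cases ht : t ∈ Icc (0 : ℝ) 1
  · calc _ ≤ |C i| := (hC i t ht).trans (le_abs_self _)
      _ ≤ ∑ i ∈ Finset.range (n + 1), |C i| :=
        Finset.single_le_sum (f := fun i => |C i|) (fun _ _ => abs_nonneg _)
          (by simpa [Nat.lt_succ_iff])
      _ ≤ _ := by linarith
  · rw [mem_Icc, not_and_or, not_le, not_le] at ht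
    refine le_trans ?_ (le_add_of_nonneg_left hs)
    rcases ht with ht | ht
    · have : Real.smoothTransition =ᶠ[𝓝 t] fun _ => (0 : ℝ) := by
        filter_upwards [Iio_mem_nhds ht] with y hy using
          Real.smoothTransition.zero_of_nonpos (le_of_lt hy)
      rw [(this.iteratedFDeriv ℝ i).eq_of_nhds]
      exact hconst i 0 t (by simp)
    · have : Real.smoothTransition =ᶠ[𝓝 t] fun _ => (1 : ℝ) := by
        filter_upwards [Ioi_mem_nhds ht] with y hy using
          Real.smoothTransition.one_of_one_le (le_of_lt hy)
      rw [(this.iteratedFDeriv ℝ i).eq_of_nhds]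
      exact hconst i 1 t (by simp)

/-- A smooth `1/N`-periodic function vanishing where `|sin (π N x)| ≤ 4 / D`. -/
def cutoff (D N : ℕ) (x : ℝ) : ℝ :=
  Real.smoothTransition ((D : ℝ) ^ 2 / 16 * Real.sin (Real.pi * N * x) ^ 2 - 1)

theorem contDiff_cutoff (D N : ℕ) : ContDiff ℝ ∞ (cutoff D N) :=
  (Real.smoothTransition.contDiff (n := ⊤)).comp (by fun_prop)

theorem cutoff_nonneg (D N : ℕ) (x : ℝ) : 0 ≤ cutoff D N x := Real.smoothTransition.nonneg _

theorem cutoff_le_one (D N : ℕ) (x : ℝ) : cutoff D N x ≤ 1 := Real.smoothTransition.le_one _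

theorem le_abs_sin_of_cutoff_ne_zero {D N : ℕ} (hD : 0 < D) {x : ℝ} (h : cutoff D N x ≠ 0) :
    4 / (D : ℝ) ≤ |Real.sin (Real.pi * N * x)| := by
  have h1 : 0 < (D : ℝ) ^ 2 / 16 * Real.sin (Real.pi * N * x) ^ 2 - 1 := by
    by_contra! h'
    exact h (Real.smoothTransition.zero_of_nonpos h')
  have hD' : (0 : ℝ) < D := by exact_mod_cast hD
  refine abs_le_of_sq_le_sq' ?_ (abs_nonneg _) |>.2
  rw [sq_abs, div_pow, div_le_iff₀ (by positivity)]
  nlinarith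

theorem cutoff_eq_one {D N : ℕ} {x : ℝ} (hD : 0 < D)
    (h : 32 / (D : ℝ) ^ 2 < Real.sin (Real.pi * N * x) ^ 2) : cutoff D N x = 1 := by
  have hD' : (0 : ℝ) < D := by exact_mod_cast hD
  rw [div_lt_iff₀ (by positivity)] at h
  apply Real.smoothTransition.one_of_one_le
  nlinarith

theorem exists_derivBound_cutoff (n : ℕ) : ∃ C, 1 ≤ C ∧ ∀ D N : ℕ, 0 < D → 0 < N → ∀ x,
    DerivBound n (cutoff D N) x 1 (C * (N * (D : ℝ) ^ 2)) := by
  obtain ⟨C, hC1, hC⟩ := Real.smoothTransition.exists_bound_iteratedFDeriv n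
  refine ⟨n.factorial * C * (2 * Real.pi), ?_, fun D N hD hN x i hi => ?_⟩
  · have h1 : (1 : ℝ) ≤ n.factorial := by exact_mod_cast Nat.factorial_pos n
    have := Real.pi_gt_three
    calc (1 : ℝ) = 1 * 1 * 1 := by ring
      _ ≤ _ := by gcongr; linarith
  rcases Nat.eq_zero_or_pos i with rfl | hi0
  · simpa [abs_le] using ⟨by linarith [cutoff_nonneg D N x], cutoff_le_one D N x⟩
  have hN1 : (1 : ℝ) ≤ N := by exact_mod_cast hN
  have hD1 : (1 : ℝ) ≤ D := by exact_mod_cast hD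
  have hpi := Real.pi_gt_three
  have key := norm_iteratedFDeriv_comp_le (n := i) (N := ∞) (Real.smoothTransition.contDiff (n := ⊤))
    (f := fun x : ℝ => (D : ℝ) ^ 2 / 16 * Real.sin (Real.pi * N * x) ^ 2 - 1) (by fun_prop)
    (by exact_mod_cast le_top) x (C := C) (D := 2 * Real.pi * N * (D : ℝ) ^ 2)
    (fun k hk => hC k (hk.trans hi) _) (fun k hk _ => ?_)
  · refine key.trans ?_
    have h1 : (1 : ℝ) ≤ n.factorial * C := by
      have h1 : (1 : ℝ) ≤ n.factorial := by exact_mod_cast Nat.factorial_pos n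
      nlinarith
    calc (i.factorial : ℝ) * C * (2 * Real.pi * N * (D : ℝ) ^ 2) ^ i
        ≤ (n.factorial * C) ^ i * (2 * Real.pi * N * (D : ℝ) ^ 2) ^ i := by
          gcongr
          calc (i.factorial : ℝ) * C ≤ n.factorial * C := by gcongr
            _ ≤ _ := le_self_pow₀ h1 hi0.ne'
      _ = _ := by rw [one_mul, ← mul_pow]; congr 1; ring
  · have e : (fun x : ℝ => (D : ℝ) ^ 2 / 16 * Real.sin (Real.pi * N * x) ^ 2 - 1) =
        fun x => ((D : ℝ) ^ 2 / 32 - 1) - (D : ℝ) ^ 2 / 32 * Real.cos (2 * Real.pi * N * x) := by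
      ext y
      rw [show 2 * Real.pi * N * y = 2 * (Real.pi * N * y) by ring, Real.cos_two_mul,
        Real.cos_sq']
      ring
    rw [norm_iteratedFDeriv_eq_norm_iteratedDeriv, e, iteratedDeriv_const_sub hk,
      iteratedDeriv_neg, iteratedDeriv_const_mul_field,
      iteratedDeriv_comp_const_mul (f := Real.cos) Real.contDiff_cos, norm_neg]
    rw [norm_mul, norm_mul, norm_pow, Real.norm_of_nonneg (by positivity : 0 ≤ 2 * Real.pi * (N : ℝ)),
      Real.norm_of_nonneg (by positivity : 0 ≤ (D : ℝ) ^ 2 / 32), mul_pow _ ((D : ℝ) ^ 2)]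
    calc (D : ℝ) ^ 2 / 32 * ((2 * Real.pi * N) ^ k * _)
        ≤ (D : ℝ) ^ 2 * ((2 * Real.pi * N) ^ k * 1) := by
          gcongr
          · linarith [sq_nonneg (D : ℝ)]
          · exact Real.abs_iteratedDeriv_cos_le_one k _
      _ ≤ ((D : ℝ) ^ 2) ^ k * ((2 * Real.pi * N) ^ k * 1) := by
          gcongr
          exact le_self_pow₀ (one_le_pow₀ hD1) (by omega)
      _ = _ := by ring

theorem norm_one_sub_le_of_norm_le_one {u : ℂ} (hu : ‖u‖ ≤ 1) {t : ℝ} (ht : 0 < t) :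
    ‖1 - u‖ ≤ (1 - u.re) / t + t / 2 := by
  have h1 : ‖1 - u‖ ^ 2 = (1 - u.re) ^ 2 + u.im ^ 2 := by
    rw [Complex.sq_norm, Complex.normSq_apply]; simp; ring
  have h2 : ‖u‖ ^ 2 = u.re ^ 2 + u.im ^ 2 := by
    rw [Complex.sq_norm, Complex.normSq_apply]; ring
  have h3 : ‖u‖ ^ 2 ≤ 1 := pow_le_one₀ (norm_nonneg _) hu
  have h4 : (1 - u.re) / t + t / 2 = (2 * (1 - u.re) + t ^ 2) / (2 * t) := by
    field_simp
  rw [h4, le_div_iff₀ (by positivity)]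
  nlinarith [sq_nonneg (‖1 - u‖ - t)]

theorem circleIntegral_norm_one_sub_le {f : ℂ → ℂ} {R : ℝ} (hR : 0 < R)
    (hf : DiffContOnCl ℂ f (Metric.ball 0 R)) (hb : ∀ z ∈ Metric.sphere (0 : ℂ) R, ‖f z‖ ≤ 1)
    {t : ℝ} (ht : 0 < t) :
    (2 * Real.pi)⁻¹ * ∫ θ in (0 : ℝ)..2 * Real.pi, ‖1 - f (circleMap 0 R θ)‖ ≤
      (1 - (f 0).re) / t + t / 2 := by
  have hcont : Continuous fun θ => f (circleMap 0 R θ) := by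
    have h1 := hf.continuousOn_ball
    rw [← continuousOn_univ]
    exact h1.comp (continuous_circleMap 0 R).continuousOn
      fun θ _ => Metric.sphere_subset_closedBall (circleMap_mem_sphere 0 hR.le θ)
  have hmean : (2 * Real.pi)⁻¹ * ∫ θ in (0 : ℝ)..2 * Real.pi, (f (circleMap 0 R θ)).re = (f 0).re := by
    have h1 := DiffContOnCl.circleAverage (f := f) (c := 0) (R := R) (by rwa [abs_of_pos hR])
    rw [← h1, Real.circleAverage_def, Complex.smul_re]
    congr 1
    exact Complex.reCLM.intervalIntegral_comp_comm (hcont.intervalIntegrable _ _)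
  have hpi := Real.pi_pos
  have hre : Continuous fun θ => (f (circleMap 0 R θ)).re := Complex.continuous_re.comp hcont
  have hre1 : Continuous fun θ => (1 - (f (circleMap 0 R θ)).re) / t :=
    (continuous_const.sub hre).div_const t
  calc _ ≤ (2 * Real.pi)⁻¹ * ∫ θ in (0 : ℝ)..2 * Real.pi,
        ((1 - (f (circleMap 0 R θ)).re) / t + t / 2) := by
        gcongr
        refine intervalIntegral.integral_mono_on (by positivity)
          ((continuous_const.sub hcont).norm.intervalIntegrable _ _)
          ((hre1.add continuous_const).intervalIntegrable _ _) fun θ _ => ?_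
        exact norm_one_sub_le_of_norm_le_one (hb _ (circleMap_mem_sphere 0 hR.le θ)) ht
    _ = _ := by
        rw [intervalIntegral.integral_add (hre1.intervalIntegrable _ _)
          (Continuous.intervalIntegrable (by fun_prop) _ _), intervalIntegral.integral_div,
          intervalIntegral.integral_sub (Continuous.intervalIntegrable (by fun_prop) _ _)
          (hre.intervalIntegrable _ _), ← hmean]
        simp only [intervalIntegral.integral_const, sub_zero, smul_eq_mul]
        field_simp

theorem integral_comp_circleMap_neg_two_pi (f : ℂ → ℝ) :
    ∫ x in (0 : ℝ)..1, f (Complex.exp (-((2 * Real.pi * x : ℝ) * Complex.I))) =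
      (2 * Real.pi)⁻¹ * ∫ θ in (0 : ℝ)..2 * Real.pi, f (circleMap 0 1 θ) := by
  have hpi := Real.pi_pos
  have h1 : ∀ x : ℝ, Complex.exp (-((2 * Real.pi * x : ℝ) * Complex.I)) =
      circleMap 0 1 (-(2 * Real.pi) * x) := by
    intro x
    simp [circleMap]
  simp only [h1]
  rw [intervalIntegral.integral_comp_mul_left (fun θ => f (circleMap 0 1 θ)) (by simp),
    intervalIntegral.integral_symm, smul_eq_mul]
  have h2 : Function.Periodic (fun θ => f (circleMap 0 1 θ)) (2 * Real.pi) := fun θ => by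
    simp only [periodic_circleMap 0 1 θ]
  have h3 := h2.intervalIntegral_add_eq (-(2 * Real.pi)) 0
  simp only [neg_add_cancel, zero_add] at h3
  simp only [mul_one, mul_zero, h3, inv_neg]
  ring

theorem re_one_div_one_sub_nonneg {u : ℂ} (hu : ‖u‖ < 1) : 0 ≤ (1 / (1 - u)).re := by
  rw [one_div, Complex.inv_re]
  have := (Complex.re_le_norm u).trans hu.le
  exact div_nonneg (by simpa using this) (Complex.normSq_nonneg _)

theorem le_re_one_div_one_sub {u : ℂ} {δ : ℝ} (hδ : 0 < δ) (hu : ‖u‖ ≤ 1 - δ / 2)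
    (h : ‖1 - u‖ ≤ 14 * δ) : 1 / (392 * δ) ≤ (1 / (1 - u)).re := by
  have h1 : δ / 2 ≤ (1 - u).re := by
    have := Complex.re_le_norm u
    simp only [Complex.sub_re, Complex.one_re]
    linarith
  have h2 : 0 < ‖1 - u‖ := lt_of_lt_of_le (by linarith) (Complex.re_le_norm _)
  rw [one_div (1 - u), Complex.inv_re, ← Complex.sq_norm]
  calc 1 / (392 * δ) = (δ / 2) / (14 * δ) ^ 2 := by field_simp; norm_num
    _ ≤ _ := by gcongr; linarith

/-- A bounded analytic function which is very small near the `k`-th roots of unity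
for `N ≤ k < N + r`. -/
def damping (c ρ : ℝ) (N r : ℕ) (w : ℂ) : ℂ :=
  Complex.exp (-(c * ∑ j ∈ Finset.range r, 1 / (1 - ρ * w ^ (N + j))))

section damping

variable {c ρ : ℝ} {N r : ℕ} {w : ℂ}

theorem norm_damping (c ρ : ℝ) (N r : ℕ) (w : ℂ) : ‖damping c ρ N r w‖ =
    Real.exp (-(c * ∑ j ∈ Finset.range r, (1 / (1 - ρ * w ^ (N + j))).re)) := by
  rw [damping, Complex.norm_exp]
  simp [Complex.re_sum]

theorem norm_damping_le_one (hc : 0 ≤ c) (h : ∀ j < r, ‖ρ * w ^ (N + j)‖ < 1) :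
    ‖damping c ρ N r w‖ ≤ 1 := by
  rw [norm_damping, Real.exp_le_one_iff, neg_nonpos]
  exact mul_nonneg hc (Finset.sum_nonneg fun j hj =>
    re_one_div_one_sub_nonneg (h j (Finset.mem_range.1 hj)))

theorem norm_damping_le_exp (hc : 0 ≤ c) (h : ∀ j < r, ‖ρ * w ^ (N + j)‖ < 1) {j : ℕ} (hj : j < r)
    {B : ℝ} (hB : B ≤ (1 / (1 - ρ * w ^ (N + j))).re) :
    ‖damping c ρ N r w‖ ≤ Real.exp (-(c * B)) := by
  rw [norm_damping, Real.exp_le_exp, neg_le_neg_iff]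
  refine mul_le_mul_of_nonneg_left (hB.trans ?_) hc
  exact Finset.single_le_sum (f := fun j => (1 / (1 - ρ * w ^ (N + j))).re)
    (fun j hj => re_one_div_one_sub_nonneg (h j (Finset.mem_range.1 hj))) (Finset.mem_range.2 hj)

theorem one_sub_ne_zero_of_norm_lt_one {u : ℂ} (h : ‖u‖ < 1) : 1 - u ≠ 0 := by
  intro h0
  rw [← sub_eq_zero.1 h0] at h
  simp at h

theorem differentiableAt_damping (h : ∀ j < r, ‖ρ * w ^ (N + j)‖ < 1) :
    DifferentiableAt ℂ (damping c ρ N r) w := by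
  unfold damping
  refine ((DifferentiableAt.fun_sum fun j hj => ?_).const_mul _).neg.cexp
  exact (differentiableAt_const _).div (by fun_prop)
    (one_sub_ne_zero_of_norm_lt_one (h j (Finset.mem_range.1 hj)))

theorem damping_zero (hN : 0 < N) : damping c ρ N r 0 = Real.exp (-(c * r)) := by
  have : ∀ j, (0 : ℂ) ^ (N + j) = 0 := fun j => zero_pow (by omega)
  simp [damping, this]

theorem exists_one_lt_radius (hρ0 : 0 ≤ ρ) (hρ : ρ < 1) (N r : ℕ) : ∃ R, 1 < R ∧ ∀ j < r, ∀ w : ℂ,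
    ‖w‖ ≤ R → ‖ρ * w ^ (N + j)‖ < 1 := by
  have h1 : ∀ᶠ R in 𝓝 (1 : ℝ), ρ * R ^ (N + r) < 1 :=
    (Continuous.tendsto (f := fun R : ℝ => ρ * R ^ (N + r)) (by fun_prop) 1).eventually_lt_const
      (by simpa)
  obtain ⟨R, hR, hR1⟩ := ((h1.filter_mono nhdsWithin_le_nhds).and
    (self_mem_nhdsWithin (s := Ioi 1))).exists
  have hR1' : 1 < R := hR1
  refine ⟨R, hR1, fun j hj w hw => lt_of_le_of_lt ?_ hR⟩
  rw [norm_mul, norm_pow, Complex.norm_real, Real.norm_of_nonneg hρ0]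
  gcongr
  calc ‖w‖ ^ (N + j) ≤ R ^ (N + j) := by gcongr
    _ ≤ _ := pow_le_pow_right₀ hR1'.le (by omega)

end damping

theorem contDiff_comp_ofReal {f : ℂ → ℂ} (hf : ∀ x : ℝ, AnalyticAt ℂ f x) :
    ContDiff ℝ ∞ fun x : ℝ => f x :=
  contDiff_iff_contDiffAt.2 fun x =>
    ((hf x).contDiffAt.restrict_scalars ℝ).comp x Complex.ofRealCLM.contDiff.contDiffAt

theorem iteratedDeriv_comp_ofReal {f : ℂ → ℂ} (hf : ∀ x : ℝ, AnalyticAt ℂ f x) (n : ℕ) (x : ℝ) :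
    iteratedDeriv n (fun x : ℝ => f x) x = iteratedDeriv n f x := by
  induction n generalizing x with
  | zero => simp
  | succ n ih =>
    rw [iteratedDeriv_succ, iteratedDeriv_succ, funext ih]
    have h : AnalyticAt ℂ (iteratedDeriv n f) x := by
      rw [iteratedDeriv_eq_iterate]
      exact (hf x).iterated_deriv n
    exact h.differentiableAt.hasDerivAt.comp_ofReal.deriv

/-- The exponential `e^{-2πiz}` on the complex plane. -/
def unitExp (z : ℂ) : ℂ := Complex.exp (-(2 * Real.pi * z * Complex.I))

theorem norm_unitExp_ofReal (x : ℝ) : ‖unitExp x‖ = 1 := by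
  have : (2 * Real.pi * x * Complex.I : ℂ) = ((2 * Real.pi * x : ℝ) : ℂ) * Complex.I := by
    push_cast; rfl
  rw [unitExp, this, norm_cexp_neg_mul_I]

theorem unitExp_pow (z : ℂ) (k : ℕ) : unitExp z ^ k = unitExp (k * z) := by
  rw [unitExp, ← Complex.exp_nat_mul, unitExp]
  congr 1
  ring

theorem norm_one_sub_unitExp_ofReal (x : ℝ) : ‖1 - unitExp x‖ = 2 * |Real.sin (Real.pi * x)| := by
  have h1 : unitExp x = Complex.exp ((-(2 * Real.pi * x) : ℝ) * Complex.I) := by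
    rw [unitExp]; congr 1; push_cast; ring
  have h2 : ‖1 - unitExp x‖ ^ 2 = (2 * |Real.sin (Real.pi * x)|) ^ 2 := by
    rw [h1, Complex.sq_norm, Complex.normSq_apply, Complex.sub_re, Complex.sub_im,
      Complex.exp_ofReal_mul_I_re, Complex.exp_ofReal_mul_I_im]
    simp only [Complex.one_re, Complex.one_im, Real.cos_neg, Real.sin_neg, mul_pow, sq_abs]
    have e : 2 * Real.pi * x = 2 * (Real.pi * x) := by ring
    rw [e, Real.cos_two_mul, Real.sin_two_mul, Real.cos_sq']
    have h4 : Real.cos (Real.pi * x) ^ 2 = 1 - Real.sin (Real.pi * x) ^ 2 := Real.cos_sq' _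
    linear_combination (4 * Real.sin (Real.pi * x) ^ 2) * h4
  exact (sq_eq_sq₀ (norm_nonneg _) (by positivity)).1 h2

theorem norm_unitExp_sub_le {x : ℝ} {z : ℂ} {k : ℕ} {δ : ℝ} (hδ : δ ≤ 1)
    (hz : k * ‖z - x‖ ≤ δ / 100) : ‖unitExp (k * z) - unitExp (k * x)‖ ≤ δ / 4 := by
  have h1 : unitExp (k * z) = unitExp (k * x) *
      Complex.exp (-(2 * Real.pi * (k * (z - x)) * Complex.I)) := by
    rw [unitExp, unitExp, ← Complex.exp_add]; congr 1; ring
  have h2 : ‖unitExp (k * x)‖ = 1 := by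
    have := norm_unitExp_ofReal (k * x)
    push_cast at this
    exact this
  have hpi := Real.pi_lt_d2
  have hpi0 := Real.pi_pos
  have h3 : ‖(-(2 * Real.pi * (k * (z - x)) * Complex.I) : ℂ)‖ = 2 * Real.pi * (k * ‖z - x‖) := by
    simp [abs_of_pos hpi0]
  have h5 : 2 * Real.pi * (k * ‖z - x‖) ≤ 2 * Real.pi * (δ / 100) := by gcongr
  have h6 : 0 ≤ k * ‖z - x‖ := by positivity
  have h4 := Complex.norm_exp_sub_one_le (x := -(2 * Real.pi * (k * (z - x)) * Complex.I))
    (by rw [h3]; nlinarith)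
  rw [h1, ← mul_sub_one, norm_mul, h2, one_mul]
  refine h4.trans ?_
  rw [h3]
  nlinarith

section

variable {c δ : ℝ} {N r M : ℕ} {x : ℝ} {z : ℂ}

theorem norm_mul_unitExp_pow_le (hδ0 : 0 < δ) (hδ : δ ≤ 1) {k : ℕ} (hkM : k ≤ M)
    (hz : M * ‖z - x‖ ≤ δ / 100) : ‖((1 - δ : ℝ) : ℂ) * unitExp z ^ k‖ ≤ 1 - δ / 2 := by
  have hk : (k : ℝ) ≤ M := by exact_mod_cast hkM
  have h1 := norm_unitExp_sub_le (k := k) hδ (le_trans (by gcongr) hz)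
  have h2 : ‖unitExp (k * x)‖ = 1 := by
    have := norm_unitExp_ofReal (k * x)
    push_cast at this
    exact this
  have h3 : ‖unitExp (k * z)‖ ≤ 1 + δ / 4 := by
    have := norm_le_norm_add_norm_sub' (unitExp (k * z)) (unitExp (k * x))
    linarith
  rw [norm_mul, Complex.norm_real, Real.norm_of_nonneg (by linarith), unitExp_pow]
  calc (1 - δ) * ‖unitExp (k * z)‖ ≤ (1 - δ) * (1 + δ / 4) := by gcongr
    _ ≤ _ := by nlinarith

theorem norm_one_sub_mul_unitExp_pow_le (hδ0 : 0 < δ) (hδ : δ ≤ 1) {k : ℕ} (hkM : k ≤ M)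
    (hz : M * ‖z - x‖ ≤ δ / 100) (hx : |Real.sin (Real.pi * k * x)| ≤ 6 * δ) :
    ‖1 - ((1 - δ : ℝ) : ℂ) * unitExp z ^ k‖ ≤ 14 * δ := by
  have hk : (k : ℝ) ≤ M := by exact_mod_cast hkM
  have h1 := norm_unitExp_sub_le (k := k) hδ (le_trans (by gcongr) hz)
  have h2 : ‖1 - unitExp (k * x)‖ ≤ 12 * δ := by
    have := norm_one_sub_unitExp_ofReal (k * x)
    push_cast at this
    rw [this, ← mul_assoc]
    linarith
  have e : 1 - ((1 - δ : ℝ) : ℂ) * unitExp z ^ k = (δ : ℂ) + ((1 - δ : ℝ) : ℂ) *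
      ((1 - unitExp (k * x)) - (unitExp (k * z) - unitExp (k * x))) := by
    rw [unitExp_pow]; push_cast; ring
  have h3 : ‖(1 - unitExp (k * x)) - (unitExp (k * z) - unitExp (k * x))‖ ≤ 12 * δ + δ / 4 :=
    (norm_sub_le _ _).trans (add_le_add h2 h1)
  rw [e]
  refine (norm_add_le _ _).trans ?_
  rw [norm_mul, Complex.norm_real, Complex.norm_real, Real.norm_of_nonneg hδ0.le,
    Real.norm_of_nonneg (by linarith)]
  calc δ + (1 - δ) * _ ≤ δ + 1 * (12 * δ + δ / 4) := by gcongr; linarith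
    _ ≤ _ := by linarith

theorem differentiable_unitExp : Differentiable ℂ unitExp := by
  unfold unitExp; fun_prop

theorem analyticAt_damping_unitExp (hδ0 : 0 < δ) (hδ : δ ≤ 1) (x : ℝ) :
    AnalyticAt ℂ (fun z => damping c (1 - δ) N r (unitExp z)) x := by
  have hopen : IsOpen {z : ℂ | ∀ j ∈ Finset.range r, ‖((1 - δ : ℝ) : ℂ) * unitExp z ^ (N + j)‖ < 1} := by
    simp only [ofPred_forall]
    refine isOpen_biInter_finset fun j _ => isOpen_lt ?_ continuous_const
    have := differentiable_unitExp.continuous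
    fun_prop
  have hx : ∀ j ∈ Finset.range r, ‖((1 - δ : ℝ) : ℂ) * unitExp x ^ (N + j)‖ < 1 := fun j _ =>
    (norm_mul_unitExp_pow_le (x := x) hδ0 hδ le_rfl (by simp; linarith)).trans_lt (by linarith)
  refine Complex.analyticAt_iff_eventually_differentiableAt.2 ?_
  filter_upwards [hopen.mem_nhds hx] with z hz
  exact (differentiableAt_damping fun j hj => hz j (Finset.mem_range.2 hj)).comp z
    differentiable_unitExp.differentiableAt

theorem derivBound_damping {n : ℕ} (hc : 0 ≤ c) (hδ0 : 0 < δ) (hδ : δ ≤ 1)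
    (hM : N + r ≤ M) (hM0 : 0 < M) {j : ℕ} (hj : j < r)
    (hx : |Real.sin (Real.pi * (N + j : ℕ) * x)| ≤ 6 * δ) :
    DerivBound n (fun x : ℝ => damping c (1 - δ) N r (unitExp x)) x
      (Real.exp (-(c * (1 / (392 * δ))))) (n * (M * 100 / δ)) := by
  intro i hi
  have hM' : (0 : ℝ) < M := by exact_mod_cast hM0
  have hR : 0 < δ / 100 / M := by positivity
  have hz : ∀ z ∈ Metric.closedBall (x : ℂ) (δ / 100 / M), M * ‖z - x‖ ≤ δ / 100 := by
    intro z hz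
    rw [mem_closedBall_iff_norm, le_div_iff₀ hM'] at hz
    linarith
  have hlt : ∀ z ∈ Metric.closedBall (x : ℂ) (δ / 100 / M), ∀ j < r,
      ‖((1 - δ : ℝ) : ℂ) * unitExp z ^ (N + j)‖ < 1 := fun z hzz j hj =>
    (norm_mul_unitExp_pow_le hδ0 hδ (by omega) (hz z hzz)).trans_lt (by linarith)
  have hd : DifferentiableOn ℂ (fun z => damping c (1 - δ) N r (unitExp z))
      (Metric.closedBall (x : ℂ) (δ / 100 / M)) := fun z hzz =>
    ((differentiableAt_damping (hlt z hzz)).comp z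
      differentiable_unitExp.differentiableAt).differentiableWithinAt
  have key := Complex.norm_iteratedDeriv_le_of_forall_mem_sphere_norm_le i hR
    (hd.mono Metric.closure_ball_subset_closedBall).diffContOnCl
    (C := Real.exp (-(c * (1 / (392 * δ))))) fun z hzz => ?_
  · rw [norm_iteratedFDeriv_eq_norm_iteratedDeriv,
      iteratedDeriv_comp_ofReal (f := fun z => damping c (1 - δ) N r (unitExp z))
        (analyticAt_damping_unitExp hδ0 hδ)]
    refine key.trans ?_
    have hfac : (i.factorial : ℝ) ≤ n ^ i := by
      exact_mod_cast (Nat.factorial_le_pow i).trans (Nat.pow_le_pow_left hi i)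
    rw [div_eq_mul_inv, ← inv_pow, inv_div, mul_pow]
    calc _ ≤ (n : ℝ) ^ i * Real.exp (-(c * (1 / (392 * δ)))) * (M / (δ / 100)) ^ i := by gcongr
      _ = _ := by
        rw [show (M : ℝ) * 100 / δ = M / (δ / 100) by field_simp]
        ring
  · have hzz' := Metric.sphere_subset_closedBall hzz
    refine norm_damping_le_exp hc (hlt z hzz') hj (le_re_one_div_one_sub hδ0 ?_ ?_)
    · exact norm_mul_unitExp_pow_le hδ0 hδ (by omega) (hz z hzz')
    · exact norm_one_sub_mul_unitExp_pow_le hδ0 hδ (by omega) (hz z hzz') hx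

end

theorem exists_hasSum_pow_of_differentiableOn {f : ℂ → ℂ} {R η : ℝ} (hR : 1 < R)
    (hf : DifferentiableOn ℂ f (Metric.closedBall 0 R))
    (hη : (2 * Real.pi)⁻¹ * ∫ θ in (0 : ℝ)..2 * Real.pi, ‖f (circleMap 0 R θ)‖ ≤ η) :
    ∃ a : ℕ → ℂ, (Summable fun k => ‖a k‖) ∧ (∀ k, ‖a k‖ ≤ η) ∧
      ∀ w : ℂ, ‖w‖ = 1 → HasSum (fun k => a k * w ^ k) (f w) := by
  lift R to NNReal using by linarith
  have hR0 : 0 < R := by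
    have : (0 : ℝ) < R := by linarith
    exact_mod_cast this
  have hR1 : (1 : ℝ) < R := hR
  have hps := hf.hasFPowerSeriesOnBall hR0
  have hpi := Real.pi_pos
  have hη0 : 0 ≤ η := le_trans (mul_nonneg (by positivity)
    (intervalIntegral.integral_nonneg (by positivity) fun _ _ => norm_nonneg _)) hη
  have hb : ∀ k, ‖(cauchyPowerSeries f 0 R).coeff k‖ ≤ η * ((R : ℝ)⁻¹) ^ k := fun k => by
    rw [← FormalMultilinearSeries.norm_apply_eq_norm_coef]
    refine (norm_cauchyPowerSeries_le f 0 R k).trans ?_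
    rw [NNReal.abs_eq]
    gcongr
  have hRi : ((R : ℝ)⁻¹) < 1 := inv_lt_one_of_one_lt₀ hR1
  refine ⟨fun k => (cauchyPowerSeries f 0 R).coeff k, ?_, fun k => (hb k).trans ?_, fun w hw => ?_⟩
  · exact Summable.of_nonneg_of_le (fun _ => norm_nonneg _) hb
      ((summable_geometric_of_lt_one (by positivity) hRi).mul_left _)
  · exact mul_le_of_le_one_right hη0 (pow_le_one₀ (by positivity) hRi.le)
  · have h := hps.hasSum (y := w) (by
      rw [Metric.mem_eball, edist_zero_right, ← ofReal_norm, hw]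
      simpa using hR1)
    rw [zero_add] at h
    refine h.of_eq (fun k => ?_) rfl
    rw [FormalMultilinearSeries.apply_eq_pow_smul_coeff, smul_eq_mul, mul_comm]

theorem hasSum_cmFT_mul_unitExp {ν : Measure ℝ} {s : ℝ → ℂ} (hs : Integrable s ν) {f : ℂ → ℂ}
    {a : ℕ → ℂ} (ha : Summable fun k => ‖a k‖)
    (hf : ∀ w : ℂ, ‖w‖ = 1 → HasSum (fun k => a k * w ^ k) (f w)) (ξ : ℝ) :
    HasSum (fun k : ℕ => a k * cmFT ν s (ξ + k)) (cmFT ν (fun x => s x * f (unitExp x)) ξ) := by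
  have hexp : ∀ (k : ℕ) (x : ℝ), Complex.exp (-(((2 * Real.pi * (ξ + k) * x : ℝ) : ℂ) * Complex.I)) =
      Complex.exp (-(((2 * Real.pi * ξ * x : ℝ) : ℂ) * Complex.I)) * unitExp x ^ k := by
    intro k x
    rw [unitExp_pow, unitExp, ← Complex.exp_add]
    congr 1
    push_cast
    ring
  have hnorm : ∀ (k : ℕ) (x : ℝ),
      ‖a k * (Complex.exp (-(((2 * Real.pi * (ξ + k) * x : ℝ) : ℂ) * Complex.I)) * s x)‖ =
        ‖a k‖ * ‖s x‖ := fun k x => by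
    rw [norm_mul, norm_mul, norm_cexp_neg_mul_I, one_mul]
  have h := hasSum_integral_of_summable_integral_norm (μ := ν)
    (F := fun (k : ℕ) x =>
      a k * (Complex.exp (-(((2 * Real.pi * (ξ + k) * x : ℝ) : ℂ) * Complex.I)) * s x))
    (fun k => (integrable_cexp_mul hs (ξ + k)).const_mul _) (by
      simp only [hnorm, integral_const_mul]
      exact ha.mul_right _)
  refine h.of_eq (fun k => ?_) ?_
  · rw [integral_const_mul, cmFT]
  · rw [cmFT]
    refine integral_congr_ae (.of_forall fun x => HasSum.tsum_eq ?_)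
    refine ((hf (unitExp x) (norm_unitExp_ofReal x)).mul_left
      (Complex.exp (-(((2 * Real.pi * ξ * x : ℝ) : ℂ) * Complex.I)) * s x)).of_eq (fun k => ?_) ?_
    · rw [hexp]; ring
    · ring

theorem norm_cmFT_mul_unitExp_mul_pow_le {ν : Measure ℝ} {s : ℝ → ℂ} (hs : Integrable s ν)
    {f : ℂ → ℂ} {R η C : ℝ} {n : ℕ} (hR : 1 < R) (hC : 0 ≤ C)
    (hf : DifferentiableOn ℂ f (Metric.closedBall 0 R))
    (hη : (2 * Real.pi)⁻¹ * ∫ θ in (0 : ℝ)..2 * Real.pi, ‖f (circleMap 0 R θ)‖ ≤ η)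
    (hdecay : ∀ ξ : ℝ, 0 < ξ → ‖cmFT ν s ξ‖ * ξ ^ (n + 2) ≤ C) {ξ : ℝ} (hξ : 1 ≤ ξ) :
    ‖cmFT ν (fun x => s x * f (unitExp x)) ξ‖ * ξ ^ n ≤
      η * C * ∑' k : ℕ, 1 / ((k : ℝ) + 1) ^ 2 := by
  obtain ⟨a, ha, haη, hsum⟩ := exists_hasSum_pow_of_differentiableOn hR hf hη
  have hη0 : 0 ≤ η := (norm_nonneg _).trans (haη 0)
  have h := hasSum_cmFT_mul_unitExp hs ha hsum ξ
  have hsq : Summable fun k : ℕ => 1 / ((k : ℝ) + 1) ^ 2 := by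
    have := (summable_nat_add_iff 1).2 (Real.summable_one_div_nat_pow.2 one_lt_two)
    simpa using this
  have hξ0 : 0 < ξ := by linarith
  have hbound : ∀ k : ℕ, ‖a k * cmFT ν s (ξ + k)‖ ≤ η * C / ξ ^ n * (1 / ((k : ℝ) + 1) ^ 2) := by
    intro k
    have hk : (0 : ℝ) ≤ k := k.cast_nonneg
    have h1 := hdecay (ξ + k) (by positivity)
    rw [← le_div_iff₀ (by positivity)] at h1
    rw [norm_mul]
    calc ‖a k‖ * ‖cmFT ν s (ξ + k)‖ ≤ η * (C / (ξ + k) ^ (n + 2)) := by gcongr; exact haη k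
      _ ≤ η * (C / (ξ ^ n * ((k : ℝ) + 1) ^ 2)) := by
        rw [pow_add, add_comm (k : ℝ) 1]
        gcongr
        linarith
      _ = _ := by field_simp
  rw [← h.tsum_eq, ← le_div_iff₀ (by positivity)]
  refine (tsum_of_norm_bounded (hsq.mul_left _).hasSum hbound).trans_eq ?_
  rw [tsum_mul_left]
  ring

/-- A smooth function vanishing near the `N`-th roots of unity, `N` in the block of
frequencies `baseFreq L n + j`, `j < L ^ n`. -/
def cutoffProd (L n : ℕ) (x : ℝ) : ℝ :=
  ∏ j ∈ Finset.range (L ^ n), cutoff (L ^ (n + 2)) (baseFreq L n + j) x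

/-- The analytic damping function of the block `(L, n)`. -/
def blockDamping (L n : ℕ) : ℂ → ℂ :=
  damping (L / (L ^ (n + 2) : ℕ)) (1 - 1 / (L ^ (n + 2) : ℕ)) (baseFreq L n) (L ^ n)

/-- The factor attached to the block `(L, n)`. -/
def blockFactor (L n : ℕ) (x : ℝ) : ℂ :=
  cutoffProd L n x • blockDamping L n (unitExp x)

section block

variable {L n : ℕ}

theorem one_div_pow_pos (hL : 2 ≤ L) : 0 < 1 / ((L ^ (n + 2) : ℕ) : ℝ) := by
  have : 0 < L ^ (n + 2) := by positivity
  positivity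

theorem one_div_pow_le_one (hL : 2 ≤ L) : 1 / ((L ^ (n + 2) : ℕ) : ℝ) ≤ 1 := by
  have : 1 ≤ L ^ (n + 2) := Nat.one_le_pow _ _ (by omega)
  rw [div_le_one (by positivity)]
  exact_mod_cast this

theorem contDiff_cutoffProd (L n : ℕ) : ContDiff ℝ ∞ (cutoffProd L n) :=
  contDiff_prod fun _ _ => contDiff_cutoff _ _

theorem contDiff_blockDamping (hL : 2 ≤ L) :
    ContDiff ℝ ∞ fun x : ℝ => blockDamping L n (unitExp x) :=
  contDiff_comp_ofReal (f := fun z => blockDamping L n (unitExp z)) fun x =>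
    analyticAt_damping_unitExp (one_div_pow_pos hL) (one_div_pow_le_one hL) x

theorem contDiff_blockFactor (hL : 2 ≤ L) : ContDiff ℝ ∞ (blockFactor L n) :=
  (contDiff_cutoffProd L n).smul (contDiff_blockDamping hL)

theorem cutoffProd_nonneg (L n : ℕ) (x : ℝ) : 0 ≤ cutoffProd L n x :=
  Finset.prod_nonneg fun _ _ => cutoff_nonneg _ _ _

theorem cutoffProd_le_one (L n : ℕ) (x : ℝ) : cutoffProd L n x ≤ 1 :=
  Finset.prod_le_one (fun _ _ => cutoff_nonneg _ _ _) fun _ _ => cutoff_le_one _ _ _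

theorem norm_blockDamping_unitExp_le_one (hL : 2 ≤ L) (x : ℝ) :
    ‖blockDamping L n (unitExp x)‖ ≤ 1 := by
  refine norm_damping_le_one (by positivity) fun j _ => ?_
  have h1 := one_div_pow_pos (n := n) hL
  exact (norm_mul_unitExp_pow_le (x := x) h1 (one_div_pow_le_one hL) le_rfl
    (by simpa using by positivity)).trans_lt (by linarith)

theorem norm_blockFactor_le_one (hL : 2 ≤ L) (x : ℝ) : ‖blockFactor L n x‖ ≤ 1 := by
  rw [blockFactor, norm_smul, Real.norm_of_nonneg (cutoffProd_nonneg L n x)]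
  exact mul_le_one₀ (cutoffProd_le_one L n x) (norm_nonneg _) (norm_blockDamping_unitExp_le_one hL x)

theorem le_abs_sin_of_blockFactor_ne_zero (hL : 2 ≤ L) {x : ℝ} (h : blockFactor L n x ≠ 0) {j : ℕ}
    (hj : j < L ^ n) :
    4 / ((L ^ (n + 2) : ℕ) : ℝ) ≤ |Real.sin (Real.pi * (baseFreq L n + j : ℕ) * x)| := by
  refine le_abs_sin_of_cutoff_ne_zero (by positivity) fun h0 => h ?_
  rw [blockFactor, cutoffProd, Finset.prod_eq_zero (Finset.mem_range.2 hj) h0, zero_smul]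

/-- The set on which the damping has to compensate the cutoff. -/
def badSet (L n : ℕ) : Set ℝ :=
  ⋃ j ∈ Finset.range (L ^ n), {x | Real.sin (Real.pi * (baseFreq L n + j : ℕ) * x) ^ 2 ≤
    32 / ((L ^ (n + 2) : ℕ) : ℝ) ^ 2}

theorem isClosed_badSet (L n : ℕ) : IsClosed (badSet L n) :=
  isClosed_biUnion_finset fun _ _ => isClosed_le (by fun_prop) continuous_const

theorem cutoffProd_eq_one (hL : 2 ≤ L) {x : ℝ} (hx : x ∉ badSet L n) : cutoffProd L n x = 1 := by
  refine Finset.prod_eq_one fun j hj => cutoff_eq_one (by positivity) ?_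
  simp only [badSet, mem_iUnion, not_exists] at hx
  simpa using hx j hj

theorem derivBound_blockDamping (hL : 2 ≤ L) {x : ℝ} (hx : x ∈ badSet L n) :
    DerivBound n (fun x : ℝ => blockDamping L n (unitExp x)) x (Real.exp (-(L / 392)))
      (n * ((baseFreq L n + L ^ n : ℕ) * 100 / (1 / (L ^ (n + 2) : ℕ)))) := by
  simp only [badSet, mem_iUnion] at hx
  obtain ⟨j, hj, hx⟩ := hx
  have hD : (0 : ℝ) < (L ^ (n + 2) : ℕ) := by
    have : 0 < L ^ (n + 2) := by positivity
    exact_mod_cast this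
  have h := derivBound_damping (n := n) (c := L / (L ^ (n + 2) : ℕ)) (N := baseFreq L n) (r := L ^ n)
    (M := baseFreq L n + L ^ n) (x := x)
    (by positivity) (one_div_pow_pos (n := n) hL) (one_div_pow_le_one hL) le_rfl
    (by unfold baseFreq; omega) (Finset.mem_range.1 hj) (by
      refine abs_le_of_sq_le_sq (le_trans hx ?_) (by positivity)
      rw [mul_pow, div_pow]
      field_simp
      norm_num)
  have e : (L : ℝ) / (L ^ (n + 2) : ℕ) * (1 / (392 * (1 / (L ^ (n + 2) : ℕ)))) = L / 392 := by
    field_simp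
  rwa [e] at h

theorem norm_one_sub_cutoffProd_smul_le (hL : 2 ≤ L) (x : ℝ) :
    ‖(1 - cutoffProd L n x) • blockDamping L n (unitExp x)‖ ≤ Real.exp (-(L / 392)) := by
  by_cases hx : x ∈ badSet L n
  · have := derivBound_blockDamping hL hx 0 (Nat.zero_le _)
    simp only [norm_iteratedFDeriv_zero, pow_zero, mul_one] at this
    rw [norm_smul, Real.norm_of_nonneg (by linarith [cutoffProd_le_one L n x])]
    refine (mul_le_of_le_one_left (norm_nonneg _) ?_).trans this
    linarith [cutoffProd_nonneg L n x]
  · rw [cutoffProd_eq_one hL hx]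
    simp [Real.exp_nonneg]

theorem blockDamping_zero (hL : 2 ≤ L) : blockDamping L n 0 = Real.exp (-(1 / L)) := by
  have hL' : (L : ℝ) ≠ 0 := by
    have : L ≠ 0 := by omega
    exact_mod_cast this
  rw [blockDamping, damping_zero (by unfold baseFreq; omega)]
  congr 3
  push_cast
  rw [pow_add]
  field_simp

theorem exists_radius_blockDamping (hL : 2 ≤ L) : ∃ R, 1 < R ∧
    DifferentiableOn ℂ (blockDamping L n) (Metric.closedBall 0 R) ∧
    ∀ η : ℝ, 0 < η → 2 / η ^ 2 ≤ L → ∀ R' : ℝ, 0 < R' → R' ≤ R →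
      (2 * Real.pi)⁻¹ * ∫ θ in (0 : ℝ)..2 * Real.pi, ‖1 - blockDamping L n (circleMap 0 R' θ)‖ ≤ η := by
  have h1 := one_div_pow_pos (n := n) hL
  obtain ⟨R, hR, hR1⟩ := exists_one_lt_radius (ρ := 1 - 1 / ((L ^ (n + 2) : ℕ) : ℝ))
    (by linarith [one_div_pow_le_one (n := n) hL]) (by linarith) (baseFreq L n) (L ^ n)
  have hd : DifferentiableOn ℂ (blockDamping L n) (Metric.closedBall 0 R) := fun w hw =>
    (differentiableAt_damping fun j hj => hR1 j hj w (by simpa using hw)).differentiableWithinAt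
  refine ⟨R, hR, hd, fun η hη hηL R' hR' hRR => ?_⟩
  have hL0 : (0 : ℝ) < L := by
    have : 0 < L := by omega
    exact_mod_cast this
  refine (circleIntegral_norm_one_sub_le hR' (hd.mono (Metric.closure_ball_subset_closedBall.trans
    (Metric.closedBall_subset_closedBall hRR))).diffContOnCl (fun z hz => ?_) hη).trans ?_
  · refine norm_damping_le_one (by positivity) fun j hj => hR1 j hj z ?_
    rw [mem_sphere_iff_norm, sub_zero] at hz
    linarith
  · rw [blockDamping_zero hL, Complex.ofReal_re]
    have h2 := Real.add_one_le_exp (-(1 / (L : ℝ)))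
    have h3 : (1 - Real.exp (-(1 / (L : ℝ)))) / η ≤ (1 / L) / η := by gcongr; linarith
    have h4 : (1 / (L : ℝ)) / η ≤ η / 2 := by
      rw [div_le_iff₀ (by positivity)] at hηL
      rw [div_div, div_le_iff₀ (by positivity)]
      nlinarith
    linarith

theorem integral_norm_one_sub_blockFactor_le (hL : 2 ≤ L) {η : ℝ} (hη : 0 < η) (hηL : 2 / η ^ 2 ≤ L) :
    ∫ x in Icc (0 : ℝ) 1, ‖1 - blockFactor L n x‖ ≤ η + Real.exp (-(L / 392)) := by
  obtain ⟨R, hR, -, hmean⟩ := exists_radius_blockDamping (n := n) hL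
  have h1 := hmean η hη hηL 1 one_pos hR.le
  rw [← integral_comp_circleMap_neg_two_pi (fun w => ‖1 - blockDamping L n w‖)] at h1
  have hcont := (contDiff_blockDamping (n := n) hL).continuous
  have hcont1 := (contDiff_blockFactor (n := n) hL).continuous
  have hinteg : IntervalIntegrable (fun x : ℝ => ‖1 - blockDamping L n (unitExp x)‖) volume 0 1 :=
    (continuous_const.sub hcont).norm.intervalIntegrable _ _
  rw [integral_Icc_eq_integral_Ioc, ← intervalIntegral.integral_of_le zero_le_one]
  calc _ ≤ ∫ x in (0 : ℝ)..1, (‖1 - blockDamping L n (unitExp x)‖ + Real.exp (-(L / 392))) := by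
        refine intervalIntegral.integral_mono_on zero_le_one
          ((continuous_const.sub hcont1).norm.intervalIntegrable _ _)
          (hinteg.add (continuous_const.intervalIntegrable _ _))
          fun x _ => ?_
        have e : 1 - blockFactor L n x = (1 - blockDamping L n (unitExp x)) +
            (1 - cutoffProd L n x) • blockDamping L n (unitExp x) := by
          rw [blockFactor, sub_smul, one_smul]; ring
        rw [e]
        exact (norm_add_le _ _).trans (add_le_add_right (norm_one_sub_cutoffProd_smul_le hL x) _)
    _ ≤ _ := by
        rw [intervalIntegral.integral_add hinteg (continuous_const.intervalIntegrable _ _)]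
        simp only [intervalIntegral.integral_const, sub_zero, one_smul]
        refine add_le_add_left (le_trans (le_of_eq ?_) h1) _
        refine intervalIntegral.integral_congr fun x _ => ?_
        simp [unitExp]

end block

theorem baseFreq_add_le {L n : ℕ} (hL : 2 ≤ L) : baseFreq L n + L ^ n ≤ 3 * L ^ (4 * n + 6) := by
  have e : L ^ (4 * n + 6) = L ^ (3 * n + 6) * L ^ n := by rw [← pow_add]; congr 1; ring
  have h1 : L ^ n ≤ L ^ (4 * n + 6) := Nat.pow_le_pow_right (by omega) (by omega)
  have h2 : 1 ≤ L ^ (4 * n + 6) := Nat.one_le_pow _ _ (by omega)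
  unfold baseFreq
  omega

theorem exists_derivBound_cutoffProd (n : ℕ) : ∃ C, 0 < C ∧ ∀ L, 2 ≤ L → ∀ x,
    DerivBound n (cutoffProd L n) x 1 (C * (L : ℝ) ^ (7 * n + 10)) := by
  obtain ⟨C, hC, hcut⟩ := exists_derivBound_cutoff n
  refine ⟨3 * C, by positivity, fun L hL x => ?_⟩
  have hM : ((baseFreq L n + L ^ n : ℕ) : ℝ) ≤ 3 * (L : ℝ) ^ (4 * n + 6) := by
    exact_mod_cast baseFreq_add_le hL
  have hb : ∀ j ∈ Finset.range (L ^ n), DerivBound n (cutoff (L ^ (n + 2)) (baseFreq L n + j)) x 1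
      (C * (3 * (L : ℝ) ^ (4 * n + 6) * ((L ^ (n + 2) : ℕ) : ℝ) ^ 2)) := by
    intro j hj
    refine (hcut (L ^ (n + 2)) (baseFreq L n + j) (by positivity)
      (by unfold baseFreq; omega) x).mono zero_le_one (by positivity) le_rfl ?_
    gcongr
    refine le_trans ?_ hM
    have := Finset.mem_range.1 hj
    exact_mod_cast (by omega : baseFreq L n + j ≤ baseFreq L n + L ^ n)
  have h := DerivBound.prod (Finset.range (L ^ n)) (fun j _ => contDiff_cutoff _ _) hb
  have e : ((Finset.range (L ^ n)).card : ℝ) *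
      (C * (3 * (L : ℝ) ^ (4 * n + 6) * ((L ^ (n + 2) : ℕ) : ℝ) ^ 2)) =
      3 * C * (L : ℝ) ^ (7 * n + 10) := by
    rw [Finset.card_range]
    push_cast
    ring
  rw [e] at h
  exact h

theorem derivBound_blockDamping_pow {L n : ℕ} (hL : 2 ≤ L) {x : ℝ} (hx : x ∈ badSet L n) :
    DerivBound n (fun x : ℝ => blockDamping L n (unitExp x)) x (Real.exp (-(L / 392)))
      (300 * n * (L : ℝ) ^ (7 * n + 10)) := by
  have hL1 : (1 : ℝ) ≤ L := by exact_mod_cast (by omega : 1 ≤ L)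
  have hM : ((baseFreq L n + L ^ n : ℕ) : ℝ) ≤ 3 * (L : ℝ) ^ (4 * n + 6) := by
    exact_mod_cast baseFreq_add_le hL
  refine (derivBound_blockDamping hL hx).mono (Real.exp_nonneg _) (by positivity) le_rfl ?_
  rw [one_div, div_inv_eq_mul]
  calc _ ≤ (n : ℝ) * (3 * (L : ℝ) ^ (4 * n + 6) * 100 * ((L ^ (n + 2) : ℕ) : ℝ)) := by
        gcongr
    _ = 300 * n * (L : ℝ) ^ (5 * n + 8) := by
        push_cast
        ring
    _ ≤ _ := by
        gcongr <;> first | exact hL1 | omega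

theorem exists_derivBound_one_sub_cutoffProd_smul (n : ℕ) {s : ℝ → ℂ} (hs : ContDiff ℝ ∞ s)
    (h0 : ∀ x, x ∉ Icc (0 : ℝ) 1 → s x = 0) : ∃ C, 0 < C ∧ ∀ L, 2 ≤ L → ∀ x,
      ‖iteratedFDeriv ℝ n (fun x => (1 - cutoffProd L n x) •
        (blockDamping L n (unitExp x) • s x)) x‖ ≤
        C * (((L : ℝ) / 392) ^ ((7 * n + 10) * n) * Real.exp (-(L / 392))) := by
  obtain ⟨C₁, hC₁, hcut⟩ := exists_derivBound_cutoffProd n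
  obtain ⟨C₂, hC₂, hs'⟩ := exists_bound_iteratedFDeriv_of_hasCompactSupport hs
    (hasCompactSupport_of_forall_notMem_Icc h0) n
  refine ⟨C₂ * (C₁ + 300 * n + 1) ^ n * 392 ^ ((7 * n + 10) * n), by positivity,
    fun L hL x => ?_⟩
  by_cases hx : x ∈ badSet L n
  · have h1 : (1 : ℝ) ≤ (L : ℝ) ^ (7 * n + 10) :=
      one_le_pow₀ (by exact_mod_cast (by omega : 1 ≤ L))
    have b1 := (hcut L hL x).one_sub (contDiff_cutoffProd L n) (cutoffProd_nonneg L n x)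
      (cutoffProd_le_one L n x)
    have b2 := derivBound_blockDamping_pow hL hx
    have b3 : DerivBound n s x C₂ 1 := fun i hi => by simpa using hs' i hi x
    have hexp : 0 ≤ Real.exp (-((L : ℝ) / 392)) := Real.exp_nonneg _
    rw [div_pow]
    generalize Real.exp (-((L : ℝ) / 392)) = P at b2 hexp ⊢
    rw [pow_mul (L : ℝ)]
    have hK : (392 : ℝ) ^ ((7 * n + 10) * n) ≠ 0 := by positivity
    generalize (392 : ℝ) ^ ((7 * n + 10) * n) = K at hK ⊢
    generalize (L : ℝ) ^ (7 * n + 10) = T at b1 b2 h1 ⊢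
    have c1 : ContDiff ℝ ∞ fun y => 1 - cutoffProd L n y :=
      contDiff_const.sub (contDiff_cutoffProd L n)
    have c2 := contDiff_blockDamping (n := n) hL
    have b3' : DerivBound n (fun y : ℝ => blockDamping L n (unitExp y) • s y) x (P * C₂)
        (300 * n * T + 1) := DerivBound.smul (𝕜 := ℂ) c2 hs b2 b3
    have b4 : DerivBound n (fun y => (1 - cutoffProd L n y) • (blockDamping L n (unitExp y) • s y))
        x (1 * (P * C₂)) (C₁ * T + (300 * n * T + 1)) :=
      DerivBound.smul (𝕜 := ℝ) c1 (c2.smul hs) b1 b3'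
    have b5 := b4 n le_rfl
    refine b5.trans ?_
    calc 1 * (P * C₂) * (C₁ * T + (300 * n * T + 1)) ^ n ≤
        1 * (P * C₂) * ((C₁ + 300 * n + 1) * T) ^ n := by
          gcongr
          linarith
      _ = _ := by
        rw [mul_pow]
        field_simp
  · have : iteratedFDeriv ℝ n (fun x => (1 - cutoffProd L n x) •
        (blockDamping L n (unitExp x) • s x)) x = 0 := by
      rw [← norm_eq_zero, norm_iteratedFDeriv_eq_norm_iteratedDeriv,
        iteratedDeriv_eq_zero_of_notMem (isClosed_badSet L n) (fun y hy => ?_) n hx, norm_zero]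
      rw [cutoffProd_eq_one hL hy, sub_self, zero_smul]
    rw [this, norm_zero]
    positivity

theorem exists_block (n : ℕ) {s : ℝ → ℂ} (hs : ContDiff ℝ ∞ s)
    (h0 : ∀ x, x ∉ Icc (0 : ℝ) 1 → s x = 0) {ε : ℝ} (hε : 0 < ε) :
    ∃ L, 2 ≤ L ∧ ∫ x in Icc (0 : ℝ) 1, ‖1 - blockFactor L n x‖ ≤ ε ∧ ∀ ξ : ℝ, 1 ≤ ξ →
      ‖cmFT (volume.restrict (Icc 0 1)) (fun x => s x * (blockFactor L n x - 1)) ξ‖ * ξ ^ n ≤ ε := by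
  obtain ⟨C, hC, hdecay⟩ : ∃ C, 0 < C ∧ ∀ ξ : ℝ, 0 < ξ →
      ‖cmFT (volume.restrict (Icc 0 1)) s ξ‖ * ξ ^ (n + 2) ≤ C := by
    obtain ⟨C, hC, hb⟩ := exists_bound_iteratedFDeriv_of_hasCompactSupport hs
      (hasCompactSupport_of_forall_notMem_Icc h0) (n + 2)
    exact ⟨C, hC, fun ξ hξ => norm_cmFT_mul_pow_le hs h0 (hb _ le_rfl) hξ⟩
  obtain ⟨C', hC', hcorr⟩ := exists_derivBound_one_sub_cutoffProd_smul n hs h0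
  set K : ℝ := ∑' k : ℕ, 1 / ((k : ℝ) + 1) ^ 2
  have hK : 0 ≤ K := tsum_nonneg fun k => by positivity
  obtain ⟨η, hη, hη1, hη2⟩ : ∃ η : ℝ, 0 < η ∧ η ≤ ε / 2 ∧ η * C * K ≤ ε / 2 := by
    refine ⟨ε / 2 / (1 + C * K), by positivity, div_le_self (by positivity) (by
      have := mul_nonneg hC.le hK
      linarith), ?_⟩
    rw [mul_assoc, div_mul_eq_mul_div, div_le_iff₀ (by positivity)]
    nlinarith
  have hlin : Tendsto (fun L : ℕ => (L : ℝ) / 392) atTop atTop :=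
    tendsto_natCast_atTop_atTop.atTop_div_const (by norm_num)
  have t1 : Tendsto (fun L : ℕ => Real.exp (-((L : ℝ) / 392))) atTop (𝓝 0) :=
    (Real.tendsto_exp_neg_atTop_nhds_zero).comp hlin
  have t2 : Tendsto (fun L : ℕ => C' * (((L : ℝ) / 392) ^ ((7 * n + 10) * n) *
      Real.exp (-((L : ℝ) / 392)))) atTop (𝓝 (C' * 0)) :=
    ((Real.tendsto_pow_mul_exp_neg_atTop_nhds_zero _).comp hlin).const_mul C'
  rw [mul_zero] at t2
  obtain ⟨L, hL, hL1, hL2, hL3⟩ := ((eventually_ge_atTop 2).and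
    ((tendsto_natCast_atTop_atTop.eventually_ge_atTop (2 / η ^ 2)).and
    ((t1.eventually_le_const (half_pos hε)).and (t2.eventually_le_const (half_pos hε))))).exists
  refine ⟨L, hL, (integral_norm_one_sub_blockFactor_le hL hη hL1).trans (by linarith),
    fun ξ hξ => ?_⟩
  obtain ⟨R, hR, hd, hmean⟩ := exists_radius_blockDamping (n := n) hL
  have hsint : Integrable s (volume.restrict (Icc 0 1)) :=
    (hs.continuous.continuousOn.integrableOn_compact isCompact_Icc)
  have hmain := norm_cmFT_mul_unitExp_mul_pow_le hsint (f := fun w => blockDamping L n w - 1)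
    (n := n) (η := η) hR hC.le (hd.sub_const 1) (by
      simpa only [norm_sub_rev] using hmean η hη hL1 R (by linarith) le_rfl) hdecay hξ
  have hcorr' := norm_cmFT_mul_pow_le (f := fun x => (1 - cutoffProd L n x) •
        (blockDamping L n (unitExp x) • s x))
    ((contDiff_const.sub (contDiff_cutoffProd L n)).smul ((contDiff_blockDamping hL).smul hs))
    (fun x hx => by simp [h0 x hx]) (fun x => hcorr L hL x) (by linarith : 0 < ξ)
  have hcG := (contDiff_blockDamping (n := n) hL).continuous
  have e : cmFT (volume.restrict (Icc 0 1)) (fun x => s x * (blockFactor L n x - 1)) ξ =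
      cmFT (volume.restrict (Icc 0 1)) (fun x => s x * (blockDamping L n (unitExp x) - 1)) ξ -
      cmFT (volume.restrict (Icc 0 1)) (fun x => (1 - cutoffProd L n x) •
        (blockDamping L n (unitExp x) • s x)) ξ := by
    unfold cmFT
    rw [← integral_sub]
    · refine integral_congr_ae (.of_forall fun x => ?_)
      simp only [blockFactor, Complex.real_smul, smul_eq_mul]
      push_cast
      ring
    · exact integrable_cexp_mul ((hs.continuous.mul
        (hcG.sub continuous_const)).continuousOn.integrableOn_compact isCompact_Icc) ξ
    · exact integrable_cexp_mul (((continuous_const.sub (contDiff_cutoffProd L n).continuous).smul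
        (hcG.smul hs.continuous)).continuousOn.integrableOn_compact isCompact_Icc) ξ
  rw [e]
  calc _ ≤ (‖cmFT (volume.restrict (Icc 0 1))
          (fun x => s x * (blockDamping L n (unitExp x) - 1)) ξ‖ +
        ‖cmFT (volume.restrict (Icc 0 1)) (fun x => (1 - cutoffProd L n x) •
        (blockDamping L n (unitExp x) • s x)) ξ‖) * ξ ^ n := by gcongr; exact norm_sub_le _ _
    _ ≤ ε := by
      rw [add_mul]
      linarith

theorem integrable_tsum_of_summable_integral_norm {α E : Type*} [MeasurableSpace α]
    {μ : Measure α} [NormedAddCommGroup E] [CompleteSpace E] {F : ℕ → α → E}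
    (hF : ∀ i, Integrable (F i) μ) (hsum : Summable fun i => ∫ a, ‖F i a‖ ∂μ) :
    Integrable (fun a => ∑' i, F i a) μ := by
  have hne : ∑' i, ∫⁻ a, ‖F i a‖ₑ ∂μ ≠ ⊤ := by
    have e (i : ℕ) : ∫⁻ a, ‖F i a‖ₑ ∂μ = ENNReal.ofReal (∫ a, ‖F i a‖ ∂μ) :=
      (ofReal_integral_norm_eq_lintegral_enorm (hF i)).symm
    simp_rw [e]
    exact hsum.tsum_ofReal_ne_top
  have hae : ∀ᵐ a ∂μ, Summable fun i => ‖F i a‖ :=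
    summable_norm_of_tsum_eLpNorm_ne_top le_rfl (fun i => (hF i).1)
      (by simpa only [eLpNorm_one_eq_lintegral_enorm] using hne)
  refine ⟨aestronglyMeasurable_of_tendsto_ae atTop
    (f := fun n a => ∑ i ∈ Finset.range n, F i a)
    (fun n => Finset.aestronglyMeasurable_fun_sum _ fun i _ => (hF i).1) ?_, ?_⟩
  · filter_upwards [hae] with a ha using ha.of_norm.hasSum.tendsto_sum_nat
  · refine lt_of_le_of_lt (lintegral_mono fun a => enorm_tsum_le_tsum_enorm) ?_
    rw [lintegral_tsum fun i => (hF i).1.enorm]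
    exact hne.lt_top

theorem one_div_le_fract_of_le_abs_sin {D y : ℝ} (h : 4 / D ≤ |Real.sin (Real.pi * y)|) :
    1 / D ≤ Int.fract y ∧ Int.fract y ≤ 1 - 1 / D := by
  have key (n : ℤ) : 4 / D ≤ 4 * |y - n| := by
    have h1 : |Real.sin (Real.pi * y - n * Real.pi)| = |Real.sin (Real.pi * y)| := by
      rw [Real.sin_sub_int_mul_pi, abs_mul]
      simp [abs_zpow]
    calc 4 / D ≤ |Real.pi * y - n * Real.pi| := (h1 ▸ h).trans Real.abs_sin_le_abs
      _ = Real.pi * |y - n| := by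
        rw [mul_comm _ Real.pi, ← mul_sub, abs_mul, abs_of_pos Real.pi_pos]
      _ ≤ 4 * |y - n| := by gcongr; exact Real.pi_le_four
  have e : 4 / D = 4 * (1 / D) := by ring
  have k0 := key ⌊y⌋
  have k1 := key (⌊y⌋ + 1)
  have hf := Int.fract_add_floor y
  have h0 := Int.fract_nonneg y
  have h1 := (Int.fract_lt_one y).le
  push_cast at k1
  rw [abs_of_nonneg (by linarith)] at k0
  rw [abs_of_nonpos (by linarith)] at k1
  constructor <;> linarith

theorem exists_initial : ∃ s : ℝ → ℂ, ContDiff ℝ ∞ s ∧ (∀ x, x ∉ Icc (0 : ℝ) 1 → s x = 0) ∧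
    (∀ x, ‖s x‖ ≤ 1) ∧ 1 / 2 ≤ ‖∫ x in Icc (0 : ℝ) 1, s x‖ := by
  let b : ContDiffBump (1 / 2 : ℝ) := ⟨1 / 4, 1 / 2, by norm_num, by norm_num⟩
  refine ⟨fun x => (b x : ℂ), Complex.ofRealCLM.contDiff.comp b.contDiff, fun x hx => ?_,
    fun x => ?_, ?_⟩
  · have : x ∉ Function.support b := by
      rw [b.support_eq, Real.ball_eq_Ioo]
      intro h
      exact hx ⟨by linarith [h.1], by linarith [h.2]⟩
    simpa using this
  · rw [Complex.norm_real, Real.norm_of_nonneg b.nonneg]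
    exact b.le_one
  · rw [integral_complex_ofReal, Complex.norm_real]
    refine le_trans ?_ (le_abs_self _)
    calc (1 / 2 : ℝ) = ∫ x in Icc (1 / 4 : ℝ) (3 / 4), (1 : ℝ) := by
          simp; norm_num
      _ = ∫ x in Icc (1 / 4 : ℝ) (3 / 4), b x := by
          refine setIntegral_congr_fun measurableSet_Icc fun x hx => ?_
          refine (b.one_of_mem_closedBall ?_).symm
          rw [Real.closedBall_eq_Icc]
          exact ⟨by linarith [hx.1], by linarith [hx.2]⟩
      _ ≤ ∫ x in Icc (0 : ℝ) 1, b x := by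
          refine setIntegral_mono_set (b.continuous.continuousOn.integrableOn_compact isCompact_Icc)
            (.of_forall fun x => b.nonneg) (Icc_subset_Icc ?_ ?_).eventuallyLE <;> norm_num

/-- A sequence of smooth functions obtained by multiplying successively by block factors. -/
structure IsBlockSequence (s : ℕ → ℝ → ℂ) (L : ℕ → ℕ) : Prop where
  contDiff : ∀ n, ContDiff ℝ ∞ (s n)
  eq_zero : ∀ n x, x ∉ Icc (0 : ℝ) 1 → s n x = 0
  two_le : ∀ n, 2 ≤ L n
  succ : ∀ n x, s (n + 1) x = s n x * blockFactor (L n) n x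
  mass : 1 / 2 ≤ ‖∫ x in Icc (0 : ℝ) 1, s 0 x‖
  integral_le : ∀ n, ∫ x in Icc (0 : ℝ) 1, ‖s (n + 1) x - s n x‖ ≤ (1 / 2) ^ (n + 3)
  cmFT_le : ∀ n ξ, 1 ≤ ξ → ‖cmFT (volume.restrict (Icc 0 1)) (fun x => s (n + 1) x - s n x) ξ‖ *
    ξ ^ n ≤ (1 / 2) ^ (n + 3)

theorem exists_isBlockSequence : ∃ s L, IsBlockSequence s L := by
  obtain ⟨s₀, hs₀, hz₀, hb₀, hm₀⟩ := exists_initial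
  let S := {s : ℝ → ℂ // ContDiff ℝ ∞ s ∧ (∀ x, x ∉ Icc (0 : ℝ) 1 → s x = 0) ∧ ∀ x, ‖s x‖ ≤ 1}
  have step (n : ℕ) (s : S) := exists_block n s.2.1 s.2.2.1 (show (0 : ℝ) < (1 / 2) ^ (n + 3) by positivity)
  choose L hL hinteg hdec using step
  let next (n : ℕ) (s : S) : S := ⟨fun x => s.1 x * blockFactor (L n s) n x,
    s.2.1.mul (contDiff_blockFactor (hL n s)), fun x hx => by simp [s.2.2.1 x hx], fun x => by
      rw [norm_mul]
      exact mul_le_one₀ (s.2.2.2 x) (norm_nonneg _) (norm_blockFactor_le_one (hL n s) x)⟩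
  let u : ℕ → S := fun n => Nat.rec ⟨s₀, hs₀, hz₀, hb₀⟩ next n
  have e (n : ℕ) (x : ℝ) : (u (n + 1)).1 x - (u n).1 x =
      (u n).1 x * (blockFactor (L n (u n)) n x - 1) := by
    change (u n).1 x * blockFactor (L n (u n)) n x - (u n).1 x = _
    ring
  refine ⟨fun n => (u n).1, fun n => L n (u n), fun n => (u n).2.1, fun n => (u n).2.2.1,
    fun n => hL n (u n), fun n x => rfl, hm₀, fun n => ?_, fun n ξ hξ => ?_⟩
  · refine le_trans ?_ (hinteg n (u n))
    have hc : Continuous (blockFactor (L n (u n)) n) := (contDiff_blockFactor (hL n (u n))).continuous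
    have hu := (u n).2.1.continuous
    refine integral_mono
      (((u (n + 1)).2.1.continuous.sub hu).norm.continuousOn.integrableOn_compact isCompact_Icc)
      ((continuous_const.sub hc).norm.continuousOn.integrableOn_compact isCompact_Icc) fun x => ?_
    simp only [e, norm_mul, norm_sub_rev (1 : ℂ)]
    exact mul_le_of_le_one_left (norm_nonneg _) ((u n).2.2.2 x)
  · simp only [e]
    exact hdec n (u n) ξ hξ

namespace IsBlockSequence

variable {s : ℕ → ℝ → ℂ} {L : ℕ → ℕ}

theorem integrable (h : IsBlockSequence s L) (n : ℕ) : Integrable (s n) (volume.restrict (Icc 0 1)) :=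
  (h.contDiff n).continuous.continuousOn.integrableOn_compact isCompact_Icc

theorem eq_zero_of_le (h : IsBlockSequence s L) {x : ℝ} {m n : ℕ} (hmn : m ≤ n) (hm : s m x = 0) :
    s n x = 0 := by
  induction n, hmn using Nat.le_induction with
  | base => exact hm
  | succ n _ ih => rw [h.succ, ih, zero_mul]

/-- The almost everywhere limit of a block sequence. -/
def lim (s : ℕ → ℝ → ℂ) (x : ℝ) : ℂ := s 0 x + ∑' n, (s (n + 1) x - s n x)

theorem lim_eq_zero (h : IsBlockSequence s L) {x : ℝ} {m : ℕ} (hm : s m x = 0) : lim s x = 0 := by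
  rw [lim, tsum_eq_sum (s := Finset.range m), Finset.sum_range_sub (fun n => s n x), hm]
  · ring
  · intro n hn
    have : m ≤ n := by simpa using hn
    rw [h.eq_zero_of_le this hm, h.eq_zero_of_le (this.trans n.le_succ) hm, sub_zero]

theorem summable (h : IsBlockSequence s L) :
    Summable fun n => ∫ x in Icc (0 : ℝ) 1, ‖s (n + 1) x - s n x‖ :=
  Summable.of_nonneg_of_le (fun n => integral_nonneg fun x => norm_nonneg _) h.integral_le
    ((summable_nat_add_iff 3).2 (summable_geometric_of_lt_one (by norm_num) (by norm_num)))

theorem integrable_lim (h : IsBlockSequence s L) :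
    Integrable (lim s) (volume.restrict (Icc 0 1)) :=
  (h.integrable 0).add (integrable_tsum_of_summable_integral_norm
    (fun n => (h.integrable (n + 1)).sub (h.integrable n)) h.summable)

theorem cmFT_sub (h : IsBlockSequence s L) (n : ℕ) (ξ : ℝ) :
    cmFT (volume.restrict (Icc 0 1)) (fun x => s (n + 1) x - s n x) ξ =
      cmFT (volume.restrict (Icc 0 1)) (s (n + 1)) ξ - cmFT (volume.restrict (Icc 0 1)) (s n) ξ := by
  simp only [cmFT, mul_sub]
  exact integral_sub (integrable_cexp_mul (h.integrable _) ξ) (integrable_cexp_mul (h.integrable _) ξ)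

theorem tendsto_cmFT (h : IsBlockSequence s L) (ξ : ℝ) :
    Tendsto (fun n => cmFT (volume.restrict (Icc 0 1)) (s n) ξ) atTop
      (𝓝 (cmFT (volume.restrict (Icc 0 1)) (lim s) ξ)) := by
  have hd (n : ℕ) := (h.integrable (n + 1)).sub (h.integrable n)
  have hsum := hasSum_integral_of_summable_integral_norm
    (fun n => integrable_cexp_mul (hd n) ξ) (by
      simpa only [norm_mul, norm_cexp_neg_mul_I, one_mul, Pi.sub_apply] using h.summable)
  have ht := hsum.tendsto_sum_nat.const_add (cmFT (volume.restrict (Icc 0 1)) (s 0) ξ)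
  have e1 (n : ℕ) : cmFT (volume.restrict (Icc 0 1)) (s 0) ξ + ∑ i ∈ Finset.range n,
      cmFT (volume.restrict (Icc 0 1)) (fun x => s (i + 1) x - s i x) ξ =
      cmFT (volume.restrict (Icc 0 1)) (s n) ξ := by
    simp only [h.cmFT_sub, Finset.sum_range_sub (fun n => cmFT (volume.restrict (Icc 0 1)) (s n) ξ)]
    ring
  refine Tendsto.congr e1 (ht.trans (le_of_eq ?_))
  congr 1
  rw [cmFT, cmFT, ← integral_add (integrable_cexp_mul (h.integrable 0) ξ)]
  · simp only [tsum_mul_left, lim, mul_add, Pi.sub_apply]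
  · simp only [tsum_mul_left, Pi.sub_apply]
    exact integrable_cexp_mul (integrable_tsum_of_summable_integral_norm hd h.summable) ξ

theorem exists_norm_cmFT_lim_mul_pow_le (h : IsBlockSequence s L) (m : ℕ) :
    ∃ C, 0 < C ∧ ∀ ξ, 1 ≤ ξ → ‖cmFT (volume.restrict (Icc 0 1)) (lim s) ξ‖ * ξ ^ m ≤ C := by
  obtain ⟨C, hC, hb⟩ := exists_bound_iteratedFDeriv_of_hasCompactSupport (h.contDiff m)
    (hasCompactSupport_of_forall_notMem_Icc (h.eq_zero m)) m
  refine ⟨C + 1, by positivity, fun ξ hξ => ?_⟩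
  have key (k : ℕ) : ‖cmFT (volume.restrict (Icc 0 1)) (s (m + k)) ξ‖ * ξ ^ m ≤
      C + 1 - (1 / 2) ^ k := by
    induction k with
    | zero =>
      have := norm_cmFT_mul_pow_le (h.contDiff m) (h.eq_zero m) (hb m le_rfl)
        (by linarith : 0 < ξ)
      simpa using this
    | succ k ih =>
      have h1 := h.cmFT_le (m + k) ξ hξ
      rw [h.cmFT_sub] at h1
      have h2 : ξ ^ m ≤ ξ ^ (m + k) := pow_le_pow_right₀ hξ (Nat.le_add_right _ _)
      have h3 : (1 / 2 : ℝ) ^ (m + k + 3) ≤ (1 / 2) ^ (k + 1) :=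
        pow_le_pow_of_le_one (by norm_num) (by norm_num) (by omega)
      have h4 := mul_le_mul_of_nonneg_left h2 (norm_nonneg
        (cmFT (volume.restrict (Icc 0 1)) (s (m + k + 1)) ξ -
          cmFT (volume.restrict (Icc 0 1)) (s (m + k)) ξ))
      have h5 := mul_le_mul_of_nonneg_right (norm_le_norm_add_norm_sub'
        (cmFT (volume.restrict (Icc 0 1)) (s (m + k + 1)) ξ)
        (cmFT (volume.restrict (Icc 0 1)) (s (m + k)) ξ)) (by positivity : 0 ≤ ξ ^ m)
      have h6 : (1 / 2 : ℝ) ^ k = 2 * (1 / 2) ^ (k + 1) := by ring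
      rw [add_mul] at h5
      rw [← add_assoc]
      linarith
  have ht := ((h.tendsto_cmFT ξ).norm.mul_const (ξ ^ m)).comp (tendsto_add_atTop_nat m)
  refine le_of_tendsto' ht fun k => ?_
  simp only [Function.comp_apply, add_comm k m]
  have : (0 : ℝ) ≤ (1 / 2) ^ k := by positivity
  linarith [key k]

theorem not_lim_ae_eq_zero (h : IsBlockSequence s L) :
    ¬ lim s =ᵐ[volume.restrict (Icc 0 1)] 0 := by
  intro h0
  have key (n : ℕ) : 1 / 4 + (1 / 2) ^ (n + 2) ≤ ‖cmFT (volume.restrict (Icc 0 1)) (s n) 0‖ := by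
    induction n with
    | zero =>
      have := h.mass
      simp only [cmFT]
      norm_num
      linarith
    | succ n ih =>
      have h1 := (norm_cmFT_le (volume.restrict (Icc 0 1)) (fun x => s (n + 1) x - s n x) 0).trans
        (h.integral_le n)
      rw [h.cmFT_sub] at h1
      have h2 := norm_le_norm_add_norm_sub (cmFT (volume.restrict (Icc 0 1)) (s (n + 1)) 0)
        (cmFT (volume.restrict (Icc 0 1)) (s n) 0)
      have h3 : (1 / 2 : ℝ) ^ (n + 2) = 2 * (1 / 2) ^ (n + 3) := by ring
      have h4 : n + 1 + 2 = n + 3 := rfl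
      rw [h4]
      linarith
  have hge : (1 / 4 : ℝ) ≤ ‖cmFT (volume.restrict (Icc 0 1)) (lim s) 0‖ :=
    ge_of_tendsto' (h.tendsto_cmFT 0).norm fun n => by
      have : (0 : ℝ) ≤ (1 / 2) ^ (n + 2) := by positivity
      linarith [key n]
  have hz : cmFT (volume.restrict (Icc 0 1)) (lim s) 0 = 0 := by
    rw [cmFT, ← integral_zero ℝ ℂ]
    refine integral_congr_ae ?_
    filter_upwards [h0] with x hx
    rw [hx, Pi.zero_apply, mul_zero]
  rw [hz, norm_zero] at hge
  norm_num at hge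

end IsBlockSequence

/-- The points of `[0, 1]` at which all the frequencies of all the blocks are far from `ℤ`. -/
def blockSet (L : ℕ → ℕ) : Set ℝ :=
  Icc 0 1 ∩ ⋂ (n : ℕ) (j ∈ Finset.range (L n ^ n)),
    {x | 4 / ((L n ^ (n + 2) : ℕ) : ℝ) ≤ |Real.sin (Real.pi * (baseFreq (L n) n + j : ℕ) * x)|}

theorem isCompact_blockSet (L : ℕ → ℕ) : IsCompact (blockSet L) :=
  isCompact_Icc.inter_right <| isClosed_iInter fun n => isClosed_biInter fun j _ =>
    isClosed_le continuous_const (by fun_prop)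

theorem IsBlockSequence.lim_eq_zero_of_notMem {s : ℕ → ℝ → ℂ} {L : ℕ → ℕ} (h : IsBlockSequence s L)
    {x : ℝ} (hx : x ∉ blockSet L) : lim s x = 0 := by
  by_cases hI : x ∈ Icc (0 : ℝ) 1
  · simp only [blockSet, mem_inter_iff, hI, true_and, mem_iInter, not_forall, Finset.mem_range] at hx
    obtain ⟨n, j, hj, hx⟩ := hx
    refine h.lim_eq_zero (m := n + 1) ?_
    rw [h.succ, by_contra fun hne => hx (le_abs_sin_of_blockFactor_ne_zero (h.two_le n) hne hj),
      mul_zero]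
  · exact h.lim_eq_zero (h.eq_zero 0 x hI)

theorem lintegral_cmFT_eq_top {L : ℕ → ℕ} (hL : ∀ n, 2 ≤ L n) {ν : Measure ℝ} [IsFiniteMeasure ν]
    {g : ℝ → ℂ} (hg : Integrable g ν) (hE : ∀ᵐ x ∂ν, x ∉ blockSet L → g x = 0)
    (h0 : ¬ g =ᵐ[ν] 0) {q : ℝ} (hq : q < 2) :
    ∫⁻ ξ : ℝ, ENNReal.ofReal (‖cmFT ν g ξ‖ ^ q) = ⊤ := by
  by_contra hfin
  refine h0 (ae_eq_zero_of_lintegral_ne_top hL hg (fun n j hj => ?_) hq hfin)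
  filter_upwards [hE] with x hx hgx
  have hmem : x ∈ blockSet L := by_contra fun hx' => hgx (hx hx')
  simp only [blockSet, mem_inter_iff, mem_iInter, Finset.mem_range] at hmem
  have := hmem.2 n j hj
  rw [mem_ofPred_eq, mul_assoc] at this
  exact one_div_le_fract_of_le_abs_sin this

theorem IsBlockSequence.exists_norm_cmFT_lim_le_rpow {s : ℕ → ℝ → ℂ} {L : ℕ → ℕ}
    (h : IsBlockSequence s L) {A : ℝ} (hA : 0 < A) : ∃ C, 0 < C ∧ ∀ ξ, 0 < ξ →
      ‖cmFT (volume.restrict (Icc 0 1)) (lim s) ξ‖ ≤ C * ξ ^ (-A) := by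
  obtain ⟨C, hC, hb⟩ := h.exists_norm_cmFT_lim_mul_pow_le ⌈A⌉₊
  set B := ∫ x in Icc (0 : ℝ) 1, ‖lim s x‖
  have hB : 0 ≤ B := integral_nonneg fun x => norm_nonneg _
  refine ⟨C + B, by positivity, fun ξ hξ => ?_⟩
  rw [Real.rpow_neg hξ.le, ← div_eq_mul_inv, le_div_iff₀ (Real.rpow_pos_of_pos hξ A)]
  rcases le_total 1 ξ with h1 | h1
  · calc _ ≤ ‖cmFT (volume.restrict (Icc 0 1)) (lim s) ξ‖ * ξ ^ ⌈A⌉₊ := by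
          gcongr
          rw [← Real.rpow_natCast]
          exact Real.rpow_le_rpow_of_exponent_le h1 (Nat.le_ceil A)
      _ ≤ C := hb ξ h1
      _ ≤ C + B := by linarith
  · calc _ ≤ B * 1 := by
          gcongr
          · exact norm_cmFT_le _ _ _
          · exact Real.rpow_le_one hξ.le h1 hA.le
      _ ≤ C + B := by linarith

theorem stmt_14 :
    ∃ E : Set ℝ, IsCompact E ∧ 0 < volume E ∧
      -- (i) every nonzero finite complex Borel measure supported in `E` has
      -- `∫_ℝ |μ̂(ξ)|^q dξ = ∞` for all `0 < q < 2`
      (∀ (ν : Measure ℝ), IsFiniteMeasure ν → ∀ g : ℝ → ℂ,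
        Integrable g ν → (∀ᵐ x ∂ν, x ∉ E → g x = 0) → ¬ (g =ᵐ[ν] 0) →
        ∀ q : ℝ, 0 < q → q < 2 →
          (∫⁻ ξ : ℝ, ENNReal.ofReal (‖cmFT ν g ξ‖ ^ q)) = ⊤) ∧
      -- (ii) some nonzero finite complex Borel measure supported in `E` has
      -- superpolynomially decaying Fourier transform at positive frequencies
      (∃ (ν : Measure ℝ) (g : ℝ → ℂ), IsFiniteMeasure ν ∧ Integrable g ν ∧
        (∀ᵐ x ∂ν, x ∉ E → g x = 0) ∧ ¬ (g =ᵐ[ν] 0) ∧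
        ∀ A : ℝ, 0 < A → ∃ C : ℝ, 0 < C ∧
          ∀ ξ : ℝ, 0 < ξ → ‖cmFT ν g ξ‖ ≤ C * ξ ^ (-A)) := by
  obtain ⟨s, L, h⟩ := exists_isBlockSequence
  refine ⟨blockSet L, isCompact_blockSet L, pos_iff_ne_zero.2 fun h0 => h.not_lim_ae_eq_zero ?_,
    fun ν _ g hg hE hne q _ hq => lintegral_cmFT_eq_top h.two_le hg hE hne hq,
    volume.restrict (Icc 0 1), IsBlockSequence.lim s, inferInstance, h.integrable_lim,
    .of_forall fun x hx => h.lim_eq_zero_of_notMem hx, h.not_lim_ae_eq_zero,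
    fun A hA => h.exists_norm_cmFT_lim_le_rpow hA⟩
  refine ae_restrict_of_ae ?_
  filter_upwards [compl_mem_ae_iff.2 h0] with x hx using h.lim_eq_zero_of_notMem hx
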